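/- arXiv:1702.03403 — 6 statements merged into one kernel-verified Lean document; each statement's English description precedes it below -/
import Mathlib

section
/- Let p be a prime. Every sequence of 6p − 3 elements of (ℤ/pℤ)^4 contains a nonempty zero-sum subsequence of length at most 2p. -/
open Finset

/-- If each `y i ^ p` is a multiple of `p * y i`, then high powers of the ideal generated by the
`y i` acquire a factor `p` at the cost of `p - 1` in the exponent. -/
theorem sum_span_singleton_pow_le {A κ : Type*} [CommRing A] [Fintype κ] {p : ℕ} (hp : 0 < p)
    (y : κ → A) (hy : ∀ i, (p : A) * y i ∣ y i ^ p) {n : ℕ}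
    (hn : Fintype.card κ * (p - 1) + 1 ≤ n) :
    (∑ i, Ideal.span {y i}) ^ n ≤
      Ideal.span {(p : A)} * (∑ i, Ideal.span {y i}) ^ (n - (p - 1)) := by
  classical
  set I : Ideal A := ∑ i, Ideal.span {y i} with hI
  have hle (i : κ) : Ideal.span {y i} ≤ I := by
    rw [hI, Ideal.sum_eq_sup]
    exact Finset.le_sup (f := fun i => Ideal.span {y i}) (mem_univ i)
  conv_lhs => rw [hI, Finset.sum_pow_eq_sum_piAntidiag]
  rw [Ideal.sum_eq_sup]
  refine Finset.sup_le fun k hk => Ideal.mul_le_right.trans ?_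
  have hsum : ∑ i, k i = n := (mem_piAntidiag.1 hk).1
  obtain ⟨i, hi⟩ : ∃ i, p ≤ k i := by
    by_contra! h
    have : ∑ i, k i ≤ ∑ _i : κ, (p - 1) := sum_le_sum fun i _ => by have := h i; omega
    rw [sum_const, card_univ, smul_eq_mul] at this
    omega
  have hrest : k i + ∑ x ∈ univ.erase i, k x = n := by
    rw [add_sum_erase _ _ (mem_univ i), hsum]
  have hpow : Ideal.span {y i} ^ p ≤ Ideal.span {(p : A)} * Ideal.span {y i} := by
    rw [Ideal.span_singleton_pow, Ideal.span_singleton_mul_span_singleton]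
    exact Ideal.span_singleton_le_span_singleton.2 (hy i)
  calc ∏ x, Ideal.span {y x} ^ k x
      = Ideal.span {y i} ^ p * Ideal.span {y i} ^ (k i - p) *
          ∏ x ∈ univ.erase i, Ideal.span {y x} ^ k x := by
        rw [← pow_add, Nat.add_sub_cancel' hi,
          mul_prod_erase univ (fun x => Ideal.span {y x} ^ k x) (mem_univ i)]
    _ ≤ (Ideal.span {(p : A)} * I) * I ^ (k i - p) * ∏ x ∈ univ.erase i, I ^ k x := by
        refine Ideal.mul_mono (Ideal.mul_mono (hpow.trans (Ideal.mul_mono le_rfl (hle i)))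
          (Ideal.pow_right_mono (hle i) _)) ?_
        exact Finset.prod_le_prod' fun x _ => Ideal.pow_right_mono (hle x) _
    _ = Ideal.span {(p : A)} * I ^ (n - (p - 1)) := by
        rw [prod_pow_eq_pow_sum, mul_assoc, mul_assoc, ← pow_add, ← pow_succ']
        congr 2
        omega

theorem sum_span_singleton_pow_le_span_pow {A κ : Type*} [CommRing A] [Fintype κ] {p : ℕ}
    (hp : 0 < p) (y : κ → A) (hy : ∀ i, (p : A) * y i ∣ y i ^ p) (c : ℕ) {n : ℕ}
    (hn : (Fintype.card κ + c) * (p - 1) + 1 ≤ n) :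
    (∑ i, Ideal.span {y i}) ^ n ≤ Ideal.span {(p : A) ^ (c + 1)} := by
  induction c generalizing n with
  | zero =>
    rw [zero_add, pow_one]
    exact (sum_span_singleton_pow_le hp y hy (by simpa using hn)).trans Ideal.mul_le_left
  | succ c ih =>
    have h : (Fintype.card κ + (c + 1)) * (p - 1) = (Fintype.card κ + c) * (p - 1) + (p - 1) := by
      ring
    have hsplit : (Fintype.card κ + c) * (p - 1) = Fintype.card κ * (p - 1) + c * (p - 1) := by ring
    refine (sum_span_singleton_pow_le hp y hy (by omega)).trans ?_
    rw [pow_succ', ← Ideal.span_singleton_mul_span_singleton]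
    exact Ideal.mul_mono le_rfl (ih (by omega))

theorem sum_choose_card_mul_prod {A ι : Type*} [CommRing A] [DecidableEq ι] (f : ι → A)
    (s : Finset ι) (j : ℕ) :
    ∑ T ∈ s.powerset, ((#T).choose j : A) * ∏ i ∈ T, f i =
      ∑ J ∈ s.powersetCard j, (∏ i ∈ J, f i) * ∏ i ∈ s \ J, (1 + f i) := by
  calc ∑ T ∈ s.powerset, ((#T).choose j : A) * ∏ i ∈ T, f i
      = ∑ T ∈ s.powerset, ∑ _J ∈ T.powersetCard j, ∏ i ∈ T, f i := by
        simp [card_powersetCard]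
    _ = ∑ J ∈ s.powersetCard j, ∑ T ∈ Finset.Icc J s, ∏ i ∈ T, f i := by
        refine sum_comm' fun T J => ?_
        simp only [mem_powerset, mem_powersetCard, Finset.mem_Icc]
        exact ⟨fun ⟨hT, hJ, hj⟩ => ⟨⟨hJ, hT⟩, hJ.trans hT, hj⟩,
          fun ⟨⟨hJ, hT⟩, _, hj⟩ => ⟨hT, hJ, hj⟩⟩
    _ = _ := by
        refine sum_congr rfl fun J hJ => ?_
        have hJs := (mem_powersetCard.1 hJ).1
        rw [prod_one_add, mul_sum, Finset.Icc_eq_image_powerset hJs, sum_image]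
        · refine sum_congr rfl fun T hT => prod_union ?_
          exact disjoint_of_subset_right (mem_powerset.1 hT) disjoint_sdiff
        · intro T hT U hU h
          have hd : ∀ U ∈ (s \ J).powerset, (J ∪ U) \ J = U := fun U hU => by
            rw [union_sdiff_left]
            exact sdiff_eq_self_of_disjoint
              (disjoint_of_subset_left (mem_powerset.1 hU) sdiff_disjoint)
          rw [← hd T hT, ← hd U hU]
          exact congrArg (· \ J) h

/-- The signed count of zero-sum subsequences of a long sequence over `(ℤ/pℤ)^κ`, weighted by a
binomial coefficient of the length, is divisible by a power of `p`. -/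
theorem pow_dvd_sum_zero_sum_choose {κ ι : Type*} [Fintype κ] [DecidableEq κ] [DecidableEq ι]
    {p : ℕ} (hp : p.Prime) (g : ι → κ → ZMod p) (s : Finset ι) (j c : ℕ)
    (hs : (Fintype.card κ + c) * (p - 1) + 1 + j ≤ #s) :
    (p : ℤ) ^ (c + 1) ∣
      ∑ T ∈ s.powerset with ∑ i ∈ T, g i = 0, (-1) ^ #T * ((#T).choose j : ℤ) := by
  let A := AddMonoidAlgebra ℤ (κ → ZMod p)
  let e : (κ → ZMod p) → A := fun v => AddMonoidAlgebra.single v 1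
  have e_add (v w) : e (v + w) = e v * e w := by
    change _ = AddMonoidAlgebra.single v 1 * AddMonoidAlgebra.single w 1
    rw [AddMonoidAlgebra.single_mul_single, mul_one]
  have e_zero : e 0 = 1 := rfl
  let y : κ → A := fun i => 1 - e (Pi.single i 1)
  let I : Ideal A := ∑ i, Ideal.span {y i}
  have hy (i : κ) : (p : A) * y i ∣ y i ^ p := by
    have hpow (m : ℕ) : e (Pi.single i 1) ^ m = e (m • Pi.single i 1) := by
      induction m with
      | zero => simp [e_zero]
      | succ m ih => rw [pow_succ, ih, succ_nsmul, e_add]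
    have hone : e (Pi.single i 1) ^ p = 1 := by
      rw [hpow, ← Pi.single_smul]
      simp [e_zero]
    obtain ⟨r, hr⟩ := exists_add_pow_prime_eq hp (y i) (e (Pi.single i 1))
    rw [show y i + e (Pi.single i 1) = 1 by simp [y], one_pow, hone] at hr
    exact ⟨-(e (Pi.single i 1) * r), by linear_combination -hr⟩
  have hmem (v : κ → ZMod p) : 1 - e v ∈ I := by
    let H : AddSubmonoid (κ → ZMod p) :=
      { carrier := {v | 1 - e v ∈ I}
        zero_mem' := by simp [e_zero]
        add_mem' := fun {v w} hv hw => by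
          have : 1 - e (v + w) = (1 - e v) + e v * (1 - e w) := by rw [e_add]; ring
          change 1 - e (v + w) ∈ I
          rw [this]
          exact I.add_mem hv (I.mul_mem_left _ hw) }
    have : Fact p.Prime := ⟨hp⟩
    have hsingle (i : κ) : (Pi.single i 1 : κ → ZMod p) ∈ H := by
      change y i ∈ ∑ i, Ideal.span {y i}
      rw [Ideal.sum_eq_sup]
      exact Finset.le_sup (f := fun i => Ideal.span {y i}) (mem_univ i)
        (Ideal.mem_span_singleton_self _)
    have hv : v = ∑ i, (v i).val • (Pi.single i 1 : κ → ZMod p) := by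
      conv_lhs => rw [← Finset.univ_sum_single v]
      refine sum_congr rfl fun i _ => ?_
      rw [← Pi.single_smul]
      simp
    change v ∈ H
    rw [hv]
    exact sum_mem fun i _ => nsmul_mem (hsingle i) _
  have hprod (T : Finset ι) : ∏ i ∈ T, -e (g i) = (-1) ^ #T * e (∑ i ∈ T, g i) := by
    induction T using Finset.induction_on with
    | empty => simp [e_zero]
    | insert a T ha ih =>
      rw [prod_insert ha, sum_insert ha, card_insert_of_notMem ha, ih, e_add]
      ring
  have hdvd : (p : A) ^ (c + 1) ∣
      ∑ T ∈ s.powerset, ((#T).choose j : A) * ∏ i ∈ T, -e (g i) := by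
    rw [sum_choose_card_mul_prod]
    refine dvd_sum fun J hJ => Dvd.dvd.mul_left ?_ _
    obtain ⟨hJs, hJc⟩ := mem_powersetCard.1 hJ
    have hcard : #(s \ J) = #s - j := by rw [card_sdiff_of_subset hJs, hJc]
    rw [← Ideal.mem_span_singleton]
    refine sum_span_singleton_pow_le_span_pow hp.pos y hy c (n := #(s \ J)) (by omega) ?_
    rw [← prod_const]
    refine Ideal.prod_mem_prod fun i _ => ?_
    rw [← sub_eq_add_neg]
    exact hmem _
  obtain ⟨z, hz⟩ := hdvd
  refine ⟨z.coeff 0, ?_⟩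
  have hterm (T : Finset ι) : ((#T).choose j : A) * ∏ i ∈ T, -e (g i) =
      ((-1) ^ #T * ((#T).choose j : ℤ)) • e (∑ i ∈ T, g i) := by
    rw [hprod, zsmul_eq_mul]
    push_cast
    ring
  have hpz : (p : A) ^ (c + 1) * z = ((p : ℤ) ^ (c + 1)) • z := by
    rw [zsmul_eq_mul]
    push_cast
    rfl
  rw [hpz, sum_congr rfl fun T _ => hterm T] at hz
  have h0 := DFunLike.congr_fun (congrArg AddMonoidAlgebra.coeff hz) 0
  rw [AddMonoidAlgebra.coeff_smul_apply, AddMonoidAlgebra.coeff_sum, Finsupp.finsetSum_apply,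
    smul_eq_mul] at h0
  rw [← h0, sum_filter]
  refine sum_congr rfl fun T _ => ?_
  rw [AddMonoidAlgebra.coeff_smul_apply, AddMonoidAlgebra.coeff_single, Finsupp.single_apply]
  split_ifs <;> simp


theorem exists_zero_sum_subset {κ ι : Type*} [Fintype κ] [DecidableEq κ] [DecidableEq ι]
    {p : ℕ} (hp : p.Prime) (g : ι → κ → ZMod p) (s : Finset ι)
    (hs : Fintype.card κ * (p - 1) + 1 ≤ #s) :
    ∃ T ⊆ s, T.Nonempty ∧ ∑ i ∈ T, g i = 0 := by
  by_contra! h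
  have hdvd := pow_dvd_sum_zero_sum_choose hp g s 0 0 (by simpa using hs)
  rw [sum_eq_single ∅] at hdvd
  · have : p ∣ 1 := by exact_mod_cast (by simpa using hdvd : (p : ℤ) ∣ 1)
    exact hp.one_lt.ne' (Nat.dvd_one.1 this)
  · intro T hT hne
    obtain ⟨hTs, hT0⟩ := mem_filter.1 hT
    exact absurd hT0 (h T (mem_powerset.1 hTs) (nonempty_iff_ne_empty.2 hne))
  · simp

/-- Prepending a coordinate `1` records the length modulo `p`. -/
theorem sum_cons_one_eq_zero_iff {ι : Type*} {p d : ℕ} (g : ι → Fin d → ZMod p) (T : Finset ι) :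
    ∑ i ∈ T, (Fin.cons 1 (g i) : Fin (d + 1) → ZMod p) = 0 ↔ p ∣ #T ∧ ∑ i ∈ T, g i = 0 := by
  rw [← ZMod.natCast_eq_zero_iff]
  simp [funext_iff, Fin.forall_fin_succ, Finset.sum_apply]

theorem exists_short_zero_sum_subset {ι : Type*} [DecidableEq ι] {p : ℕ} (hp : p.Prime)
    (g : ι → Fin 4 → ZMod p) (s : Finset ι) (hs : #s = 6 * p - 3) :
    ∃ T ⊆ s, T.Nonempty ∧ #T ≤ 2 * p ∧ ∑ i ∈ T, g i = 0 := by
  have hp2 := hp.two_le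
  by_contra! h
  have hlong (T : Finset ι) (hT : T ⊆ s) (hne : T.Nonempty) (h0 : ∑ i ∈ T, g i = 0) :
      2 * p < #T := by
    by_contra! hc
    exact h T hT hne hc h0
  have hcompl (T U : Finset ι) (hT : T ⊆ s) (h0 : ∑ i ∈ T, g i = 0) (hU : U ⊂ T)
      (hne : U.Nonempty) (hU0 : ∑ i ∈ U, g i = 0) : 2 * p < #U ∧ 2 * p < #T - #U := by
    refine ⟨hlong U (hU.1.trans hT) hne hU0, ?_⟩
    rw [← card_sdiff_of_subset hU.1]
    refine hlong _ (sdiff_subset.trans hT) (sdiff_nonempty.2 hU.2) ?_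
    rw [← sum_sdiff hU.1, hU0, add_zero] at h0
    exact h0
  have hmid (T : Finset ι) (hT : T ⊆ s) (h0 : ∑ i ∈ T, g i = 0) (hlow : 4 * (p - 1) + 2 ≤ #T) :
      4 * p + 2 ≤ #T := by
    obtain ⟨x, hx⟩ : T.Nonempty := card_pos.1 (by omega)
    obtain ⟨U, hU, hne, hU0⟩ := exists_zero_sum_subset hp g (T.erase x) (by
      rw [card_erase_of_mem hx, Fintype.card_fin]; omega)
    have := hcompl T U hT h0 (hU.trans_ssubset (erase_ssubset hx)) hne hU0
    omega
  have hfive (T : Finset ι) (hT : T ⊆ s) (h0 : ∑ i ∈ T, g i = 0) : #T ≠ 5 * p := by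
    intro hc
    obtain ⟨x, hx⟩ : T.Nonempty := card_pos.1 (by omega)
    obtain ⟨U, hU, hne, hU0⟩ := exists_zero_sum_subset hp
      (fun i => (Fin.cons 1 (g i) : Fin 5 → ZMod p)) (T.erase x) (by
        rw [card_erase_of_mem hx, Fintype.card_fin]; omega)
    obtain ⟨⟨m, hm⟩, hU0⟩ := (sum_cons_one_eq_zero_iff g U).1 hU0
    have := hcompl T U hT h0 (hU.trans_ssubset (erase_ssubset hx)) hne hU0
    rw [hc, hm, mul_comm p m] at this
    have h2 : 2 < m := lt_of_mul_lt_mul_right this.1 p.zero_le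
    have h3 : m < 3 := lt_of_mul_lt_mul_right (by omega : m * p < 3 * p) p.zero_le
    omega
  by_cases hp3 : p = 3
  · subst hp3
    have hdvd (j : ℕ) (hj : j ≤ 4) := pow_dvd_sum_zero_sum_choose hp g s j 1 (by
      rw [Fintype.card_fin]; omega)
    -- The weight `6 + 5 k + 8 C(k, 2) + C(k, 3) + C(k, 4)` vanishes mod 9 at `k = 7, 8, 9, 14`.
    have hsum := dvd_add (dvd_add (dvd_add (dvd_add ((hdvd 0 (by norm_num)).mul_left 6)
      ((hdvd 1 (by norm_num)).mul_left 5)) ((hdvd 2 (by norm_num)).mul_left 8))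
      (hdvd 3 (by norm_num))) (hdvd 4 (by norm_num))
    simp only [mul_sum, ← sum_add_distrib] at hsum
    have hmem : (∅ : Finset ι) ∈ s.powerset.filter fun T => ∑ i ∈ T, g i = 0 := by simp
    rw [← add_sum_erase _ _ hmem, Int.dvd_add_left] at hsum
    · norm_num at hsum
    · refine dvd_sum fun T hT => ?_
      obtain ⟨hne, hT⟩ := mem_erase.1 hT
      obtain ⟨hTs, hT0⟩ := mem_filter.1 hT
      rw [mem_powerset] at hTs
      have h1 := hlong T hTs (nonempty_iff_ne_empty.2 hne) hT0
      have h2 := hmid T hTs hT0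
      have h3 := hfive T hTs hT0
      have h4 := card_le_card hTs
      have : #T = 7 ∨ #T = 8 ∨ #T = 9 ∨ #T = 14 := by omega
      rcases this with h | h | h | h <;> rw [h] <;> decide
  · have hdvd (j : ℕ) (hj : j ≤ p) := pow_dvd_sum_zero_sum_choose hp
      (fun i => (Fin.cons 1 (g i) : Fin 5 → ZMod p)) s j 0 (by rw [Fintype.card_fin]; omega)
    have hsum := dvd_sub ((hdvd 0 p.zero_le).mul_left ((3 * p).choose p : ℤ)) (hdvd p le_rfl)
    rw [mul_sum, ← sum_sub_distrib, sum_eq_single ∅] at hsum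
    · have hchoose : p ∣ (3 * p).choose p := by
        simpa [Nat.choose_eq_zero_of_lt hp.pos, Int.natCast_dvd_natCast] using hsum
      have : Fact p.Prime := ⟨hp⟩
      have hlucas := Choose.choose_modEq_choose_mod_mul_choose_div_nat
        (n := 3 * p) (k := p) (p := p)
      rw [Nat.mul_mod_left, Nat.mod_self, Nat.mul_div_cancel _ hp.pos,
        Nat.div_self hp.pos] at hlucas
      have h3 : p ∣ 3 := by simpa using (hlucas.dvd_iff dvd_rfl).1 hchoose
      exact hp3 ((Nat.prime_dvd_prime_iff_eq hp Nat.prime_three).1 h3)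
    · intro T hT hne
      obtain ⟨hTs, hT0⟩ := mem_filter.1 hT
      rw [mem_powerset] at hTs
      obtain ⟨⟨m, hm⟩, hT0⟩ := (sum_cons_one_eq_zero_iff g T).1 hT0
      have h1 := hlong T hTs (nonempty_iff_ne_empty.2 hne) hT0
      have h2 := hmid T hTs hT0
      have h3 := hfive T hTs hT0
      have h4 := card_le_card hTs
      rw [mul_comm] at hm
      have hm2 : 2 < m := lt_of_mul_lt_mul_right (hm ▸ h1) p.zero_le
      have hm6 : m < 6 := lt_of_mul_lt_mul_right (by omega : m * p < 6 * p) p.zero_le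
      have : m = 3 := by interval_cases m <;> omega
      rw [hm, this, Nat.choose_zero_right]
      push_cast
      ring
    · simp

theorem short_zero_sum_zmod_p_pow_four (p : ℕ) (hp : p.Prime) :
    ∀ S : Multiset (Fin 4 → ZMod p), S.card = 6 * p - 3 →
      ∃ T : Multiset (Fin 4 → ZMod p),
        T ≤ S ∧ T ≠ 0 ∧ T.card ≤ 2 * p ∧ T.sum = 0 := by
  classical
  intro S hS
  obtain ⟨T, -, hne, hcard, hsum⟩ := exists_short_zero_sum_subset hp
    (fun x : S => x.1) univ (by rw [card_univ, Multiset.card_coe, hS])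
  refine ⟨T.val.map fun x : S => x.1, ?_, ?_, ?_, hsum⟩
  · conv_rhs => rw [← Multiset.map_univ_coe S]
    exact Multiset.map_le_map (val_le_iff.2 (subset_univ T))
  · simpa using hne.ne_empty
  · simpa using hcard
end

section
/- Let p be a prime and d ≥ 2 an integer. Every sequence of (d + 1)·p − d elements of (ℤ/pℤ)^d contains a nonempty zero-sum subsequence of length at most (d − 1)·p. -/
open MvPolynomial in
/-- The upper bound `card σ * (p - 1) + 1` for the Davenport constant of `(ℤ/pℤ)^σ`, for a family
indexed by a finite type. -/
theorem exists_nonempty_sum_eq_zero_of_card_mul_lt {p : ℕ} [Fact p.Prime] {ι σ : Type*}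
    [Fintype ι] [Fintype σ] (a : ι → σ → ZMod p)
    (h : Fintype.card σ * (p - 1) < Fintype.card ι) :
    ∃ s : Finset ι, s.Nonempty ∧ ∑ i ∈ s, a i = 0 := by
  classical
  let f : σ → MvPolynomial ι (ZMod p) := fun j ↦ ∑ i, a i j • X i ^ (p - 1)
  have hdeg : ∑ j, (f j).totalDegree < Fintype.card ι := by
    refine lt_of_le_of_lt ?_ h
    rw [← smul_eq_mul, ← Finset.card_univ, ← Finset.sum_const]
    refine Finset.sum_le_sum fun j _ ↦ totalDegree_finsetSum_le fun i _ ↦ ?_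
    exact (totalDegree_smul_le ..).trans (totalDegree_X_pow ..).le
  have hp : p.Prime := Fact.out
  let zeroSol : {x : ι → ZMod p // ∀ j, eval x (f j) = 0} :=
    ⟨0, by simp [f, hp.one_lt, tsub_eq_zero_iff_le]⟩
  have hpos : 0 < Fintype.card {x : ι → ZMod p // ∀ j, eval x (f j) = 0} :=
    Fintype.card_pos_iff.2 ⟨zeroSol⟩
  obtain ⟨x, hx⟩ := Fintype.exists_ne_of_one_lt_card (hp.one_lt.trans_le <|
    Nat.le_of_dvd hpos (char_dvd_card_solutions_of_fintype_sum_lt p hdeg)) zeroSol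
  refine ⟨({i | x.1 i ≠ 0} : Finset ι), ?_, ?_⟩
  · rw [← Subtype.coe_ne_coe, Function.ne_iff] at hx
    exact hx.imp fun i hi ↦ Finset.mem_filter.2 ⟨Finset.mem_univ _, hi⟩
  · ext j
    simpa [f, ZMod.pow_card_sub_one, Finset.sum_filter, Finset.sum_apply] using x.2 j

/-- Every multiset of more than `card σ * (p - 1)` elements, mapped to `(ℤ/pℤ)^σ`, contains a
nonempty submultiset with zero sum. -/
theorem Multiset.exists_le_sum_map_eq_zero {p : ℕ} [Fact p.Prime] {α σ : Type*} [Fintype σ]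
    (g : α → σ → ZMod p) (S : Multiset α) (h : Fintype.card σ * (p - 1) < S.card) :
    ∃ T ≤ S, T ≠ 0 ∧ (T.map g).sum = 0 := by
  classical
  obtain ⟨s, hs, hsum⟩ := exists_nonempty_sum_eq_zero_of_card_mul_lt
    (fun i : S ↦ g i.1) (by rwa [Multiset.card_coe])
  refine ⟨s.val.map fun i : S ↦ i.1, ?_, ?_, ?_⟩
  · exact (Multiset.map_le_map (Finset.val_le_iff.2 s.subset_univ)).trans_eq S.map_univ_coe
  · simpa using hs.ne_empty
  · rw [Multiset.map_map]
    exact hsum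

theorem zero_sum_zmod_p_pow_d (p d : ℕ) (hp : p.Prime) (hd : 2 ≤ d) :
    ∀ S : Multiset (Fin d → ZMod p), S.card = (d + 1) * p - d →
      ∃ T : Multiset (Fin d → ZMod p),
        T ≤ S ∧ T ≠ 0 ∧ T.card ≤ (d - 1) * p ∧ T.sum = 0 := by
  classical
  intro S hS
  have : Fact p.Prime := ⟨hp⟩
  obtain ⟨q, rfl⟩ : ∃ q, p = q + 1 := ⟨p - 1, by have := hp.pos; omega⟩
  obtain ⟨e, rfl⟩ : ∃ e, d = e + 2 := ⟨d - 2, by omega⟩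
  have hScard : S.card = (e + 3) * q + 1 := by rw [hS, Nat.sub_eq_iff_eq_add] <;> nlinarith
  -- Appending a coordinate `1` to every vector forces the length to be divisible by `p`.
  obtain ⟨T, hTS, hT0, hTsum⟩ := S.exists_le_sum_map_eq_zero
    (fun v (j : Option (Fin (e + 2))) ↦ j.elim 1 v) (by simp [hScard])
  have hcoord (j : Option (Fin (e + 2))) : (T.map fun v ↦ j.elim 1 v).sum = 0 := by
    have := congrArg (Pi.evalAddMonoidHom (fun _ ↦ ZMod (q + 1)) j) hTsum
    rw [map_multiset_sum, Multiset.map_map] at this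
    simpa using this
  have hTzero : T.sum = 0 := by
    ext j
    have := map_multiset_sum (Pi.evalAddMonoidHom (fun _ ↦ ZMod (q + 1)) j) T
    exact this.trans (hcoord (some j))
  obtain ⟨k, hk⟩ : q + 1 ∣ T.card := by
    rw [← ZMod.natCast_eq_zero_iff]
    simpa using hcoord none
  have hTcard : T.card ≤ (e + 3) * q + 1 := hScard ▸ Multiset.card_le_card hTS
  have hkd : k < e + 3 := by
    by_contra! hcon
    nlinarith
  simp only [show e + 2 - 1 = e + 1 by omega]
  obtain hk' | rfl : k ≤ e + 1 ∨ k = e + 2 := by omega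
  · exact ⟨T, hTS, hT0, by rw [hk]; nlinarith, hTzero⟩
  -- A zero-sum sequence of length `d * p` splits into two shorter ones.
  obtain ⟨v, hv⟩ := Multiset.exists_mem_of_ne_zero hT0
  have hcard_erase := Multiset.card_erase_add_one hv
  obtain ⟨U, hU, hU0, hUsum⟩ := (T.erase v).exists_le_sum_map_eq_zero id
    (by simp only [Fintype.card_fin, Nat.add_sub_cancel]; nlinarith)
  rw [Multiset.map_id] at hUsum
  have hUT : U ≤ T := hU.trans (T.erase_le v)
  have hsplit : T - U + U = T := tsub_add_cancel_of_le hUT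
  have hcard : (T - U).card + U.card = T.card := by rw [← Multiset.card_add, hsplit]
  have hUcard := Multiset.card_le_card hU
  by_cases hUle : U.card ≤ (e + 1) * (q + 1)
  · exact ⟨U, hUT.trans hTS, hU0, hUle, hUsum⟩
  · refine ⟨T - U, tsub_le_self.trans hTS, ?_, by nlinarith, ?_⟩
    · rw [← Multiset.card_pos]
      omega
    · have := congrArg Multiset.sum hsplit
      rwa [Multiset.sum_add, hUsum, add_zero, hTzero] at this
end

section
/- Let p be an odd prime. Every sequence of 6p − 3 elements of (ℤ/pℤ)^3 contains a zero-sum subsequence whose length is exactly p or exactly 3p. -/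
open Finset

/-- The functions on `Finset ι` spanned by the indicators `I ↦ [A ⊆ I]` with `#A ≤ d`:
the restrictions to `0/1`-vectors of the polynomials of degree at most `d`. -/
def degreeLESpan (R ι : Type*) [CommRing R] [DecidableEq ι] (d : ℕ) :
    Submodule R (Finset ι → R) :=
  Submodule.span R {f | ∃ A : Finset ι, #A ≤ d ∧ f = fun I ↦ if A ⊆ I then 1 else 0}

section degreeLESpan

variable {R ι : Type*} [CommRing R] [DecidableEq ι]

lemma indicator_mem_degreeLESpan {d : ℕ} (A : Finset ι) (hA : #A ≤ d) :
    (fun I ↦ if A ⊆ I then 1 else 0) ∈ degreeLESpan R ι d :=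
  Submodule.subset_span ⟨A, hA, rfl⟩

lemma algebraMap_mem_degreeLESpan (d : ℕ) (c : R) :
    algebraMap R (Finset ι → R) c ∈ degreeLESpan R ι d := by
  rw [Algebra.algebraMap_eq_smul_one]
  refine Submodule.smul_mem _ c ?_
  convert indicator_mem_degreeLESpan (R := R) (d := d) (∅ : Finset ι) (by simp) using 1
  ext I
  simp

lemma one_mem_degreeLESpan (d : ℕ) : (1 : Finset ι → R) ∈ degreeLESpan R ι d := by
  simpa using algebraMap_mem_degreeLESpan (R := R) (ι := ι) d 1

lemma mul_mem_degreeLESpan {d e : ℕ} {f g : Finset ι → R} (hf : f ∈ degreeLESpan R ι d)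
    (hg : g ∈ degreeLESpan R ι e) : f * g ∈ degreeLESpan R ι (d + e) := by
  have h := Submodule.mul_mem_mul hf hg
  rw [degreeLESpan, degreeLESpan, Submodule.span_mul_span] at h
  refine Submodule.span_mono ?_ h
  rintro _ ⟨_, ⟨A, hA, rfl⟩, _, ⟨B, hB, rfl⟩, rfl⟩
  refine ⟨A ∪ B, (card_union_le A B).trans (add_le_add hA hB), ?_⟩
  ext I
  simp only [Pi.mul_apply, union_subset_iff]
  split_ifs <;> simp_all

lemma pow_mem_degreeLESpan {d : ℕ} {f : Finset ι → R} (hf : f ∈ degreeLESpan R ι d) (k : ℕ) :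
    f ^ k ∈ degreeLESpan R ι (k * d) := by
  induction k with
  | zero => simpa using one_mem_degreeLESpan 0
  | succ k ih =>
    rw [pow_succ, Nat.succ_mul]
    exact mul_mem_degreeLESpan ih hf

lemma prod_mem_degreeLESpan {κ : Type*} (s : Finset κ) {d : ℕ} {f : κ → Finset ι → R}
    (hf : ∀ j ∈ s, f j ∈ degreeLESpan R ι d) : ∏ j ∈ s, f j ∈ degreeLESpan R ι (#s * d) := by
  classical
  induction s using Finset.induction_on with
  | empty => simpa using one_mem_degreeLESpan 0
  | insert a s ha ih =>
    rw [prod_insert ha, card_insert_of_notMem ha, Nat.succ_mul, add_comm]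
    exact mul_mem_degreeLESpan (hf a (mem_insert_self a s))
      (ih fun j hj ↦ hf j (mem_insert_of_mem hj))

lemma sum_powerset_neg_one_pow_mul_eq_zero {d : ℕ} {f : Finset ι → R}
    (hf : f ∈ degreeLESpan R ι d) {U : Finset ι} (hU : d < #U) :
    ∑ I ∈ U.powerset, (-1) ^ #I * f I = 0 := by
  induction hf using Submodule.span_induction with
  | zero => simp
  | add f g _ _ hf hg => simp [mul_add, sum_add_distrib, hf, hg]
  | smul c f _ hf => simp [mul_left_comm _ c, ← mul_sum, hf]
  | mem f hf =>
    obtain ⟨A, hA, rfl⟩ := hf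
    obtain ⟨x, hxU, hxA⟩ := exists_mem_notMem_of_card_lt_card (hA.trans_lt hU)
    rw [← insert_erase hxU, sum_powerset_insert (notMem_erase x U), ← sum_add_distrib]
    refine sum_eq_zero fun I hI ↦ ?_
    have hxI : x ∉ I := fun h ↦ notMem_erase x U (mem_powerset.1 hI h)
    rw [card_insert_of_notMem hxI]
    simp only [subset_insert_iff_of_notMem hxA]
    ring

variable [Fintype ι]

lemma linear_mem_degreeLESpan (w : ι → R) :
    (fun I ↦ ∑ i ∈ I, w i) ∈ degreeLESpan R ι 1 := by
  have h : (fun I : Finset ι ↦ ∑ i ∈ I, w i) =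
      ∑ i, w i • (fun I : Finset ι ↦ if {i} ⊆ I then (1 : R) else 0) := by
    ext I
    simp [Finset.sum_apply]
  rw [h]
  exact Submodule.sum_mem _ fun i _ ↦
    Submodule.smul_mem _ _ (indicator_mem_degreeLESpan {i} (by simp))

lemma choose_card_mem_degreeLESpan (k : ℕ) :
    (fun I ↦ ((#I).choose k : R)) ∈ degreeLESpan R ι k := by
  have h : (fun I : Finset ι ↦ ((#I).choose k : R)) =
      ∑ A ∈ powersetCard k univ, fun I : Finset ι ↦ if A ⊆ I then (1 : R) else 0 := by
    ext I
    rw [Finset.sum_apply, sum_boole, ← card_powersetCard]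
    congr 2
    ext A
    simp [mem_powersetCard, and_comm]
  rw [h]
  exact Submodule.sum_mem _ fun A hA ↦
    indicator_mem_degreeLESpan A (mem_powersetCard.1 hA).2.le

end degreeLESpan

section ZeroSum

variable {p : ℕ} [Fact p.Prime] {ι κ : Type*} [DecidableEq ι] [Fintype ι] [Fintype κ]

lemma ZMod.one_sub_pow_card_sub_one_eq_ite (x : ZMod p) :
    1 - x ^ (p - 1) = if x = 0 then 1 else 0 := by
  have hp : p - 1 ≠ 0 := Nat.sub_ne_zero_of_lt (Fact.out : p.Prime).one_lt
  split_ifs with hx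
  · simp [hx, hp]
  · simp [ZMod.pow_card_sub_one_eq_one hx]

lemma linear_eq_zero_mem_degreeLESpan (w : ι → ZMod p) :
    (fun I ↦ if ∑ i ∈ I, w i = 0 then 1 else 0) ∈ degreeLESpan (ZMod p) ι (p - 1) := by
  simp_rw [← ZMod.one_sub_pow_card_sub_one_eq_ite]
  refine Submodule.sub_mem _ (one_mem_degreeLESpan _) ?_
  have h := pow_mem_degreeLESpan (linear_mem_degreeLESpan w) (p - 1)
  rwa [mul_one] at h

/-- Signed weighted count of the zero-sum subfamilies of `U` whose length is divisible by `p`. -/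
lemma sum_zeroSum_eq_zero (a : ι → κ → ZMod p) {e : ℕ} {g : Finset ι → ZMod p}
    (hg : g ∈ degreeLESpan (ZMod p) ι e) {U : Finset ι}
    (hU : (Fintype.card κ + 1) * (p - 1) + e < #U) :
    ∑ I ∈ U.powerset with p ∣ #I ∧ ∑ i ∈ I, a i = 0, (-1) ^ #I * g I = 0 := by
  classical
  have hsum := prod_mem_degreeLESpan (univ : Finset κ) fun j _ ↦
    linear_eq_zero_mem_degreeLESpan fun i ↦ a i j
  have hcard := linear_eq_zero_mem_degreeLESpan (p := p) fun _ : ι ↦ 1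
  have hmem := mul_mem_degreeLESpan (mul_mem_degreeLESpan hsum hcard) hg
  rw [← Nat.succ_mul, card_univ] at hmem
  rw [← sum_powerset_neg_one_pow_mul_eq_zero hmem hU, sum_filter]
  refine sum_congr rfl fun I _ ↦ ?_
  have hiff : (∑ i ∈ I, a i = 0) ↔ ∀ j ∈ (univ : Finset κ), ∑ i ∈ I, a i j = 0 := by
    simp [funext_iff, Finset.sum_apply]
  simp only [Pi.mul_apply, Finset.prod_apply, prod_boole, ← hiff, sum_const, nsmul_eq_mul,
    mul_one, ZMod.natCast_eq_zero_iff]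
  split_ifs <;> simp_all

end ZeroSum

lemma ZMod.choose_mul_self_eq (p k : ℕ) [Fact p.Prime] : ((k * p).choose p : ZMod p) = k := by
  have h := Choose.choose_modEq_choose_mod_mul_choose_div_nat (n := k * p) (k := p) (p := p)
  have hp := (Fact.out : p.Prime).pos
  rw [Nat.mul_mod_left, Nat.mod_self, Nat.mul_div_cancel _ hp, Nat.div_self hp] at h
  simpa using (ZMod.natCast_eq_natCast_iff _ _ _).2 h

theorem exists_zeroSum_finset_card_p_or_three_p {p : ℕ} [Fact p.Prime] (hodd : Odd p)
    {ι : Type*} [DecidableEq ι] [Fintype ι] (a : ι → Fin 3 → ZMod p)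
    (hι : Fintype.card ι = 6 * p - 3) :
    ∃ I : Finset ι, (#I = p ∨ #I = 3 * p) ∧ ∑ i ∈ I, a i = 0 := by
  have hp3 : 3 ≤ p := by
    have := (Fact.out : p.Prime).two_le
    obtain ⟨m, rfl⟩ := hodd
    omega
  by_contra! hno
  have hone (I : Finset ι) (hI : ∑ i ∈ I, a i = 0) : #I ≠ p := fun h ↦ hno I (.inl h) hI
  have hthree (I : Finset ι) (hI : ∑ i ∈ I, a i = 0) : #I ≠ 3 * p := fun h ↦ hno I (.inr h) hI
  have hfive (Z : Finset ι) (hZ : ∑ i ∈ Z, a i = 0) : #Z ≠ 5 * p := by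
    intro hZcard
    obtain ⟨z, hz⟩ : Z.Nonempty := card_pos.1 (by omega)
    have hU : #(Z.erase z) = 5 * p - 1 := by rw [card_erase_of_mem hz, hZcard]
    have h := sum_zeroSum_eq_zero a (one_mem_degreeLESpan 0) (U := Z.erase z)
      (by rw [hU, Fintype.card_fin]; omega)
    rw [sum_eq_single_of_mem ∅ (by simp)] at h
    · simp at h
    · intro I hI hne
      obtain ⟨hIU, ⟨k, hk⟩, hI0⟩ := by simpa only [mem_filter, mem_powerset] using hI
      have hIZ : I ⊆ Z := hIU.trans (erase_subset z Z)
      have hdiff : ∑ i ∈ Z \ I, a i = 0 := by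
        simpa [hI0, hZ] using sum_sdiff (f := a) hIZ
      have hdiffcard := card_sdiff_of_subset hIZ
      have hle := card_le_card hIU
      have hpos := card_pos.2 (nonempty_iff_ne_empty.2 hne)
      have hk5 : k < 5 := by
        by_contra! hk5
        have := Nat.mul_le_mul_left p hk5
        omega
      have h1 := hone I hI0
      have h2 := hthree I hI0
      have h3 := hone _ hdiff
      have h4 := hthree _ hdiff
      interval_cases k <;> omega
  have hchoose := choose_card_mem_degreeLESpan (R := ZMod p) (ι := ι) p
  have hweight := mul_mem_degreeLESpan
    (Submodule.sub_mem _ hchoose (algebraMap_mem_degreeLESpan p 2))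
    (Submodule.sub_mem _ hchoose (algebraMap_mem_degreeLESpan p 4))
  have h := sum_zeroSum_eq_zero a hweight (U := univ)
    (by rw [card_univ, hι, Fintype.card_fin]; omega)
  rw [sum_eq_single_of_mem ∅ (by simp)] at h
  · have h8 : ((2 ^ 3 : ℕ) : ZMod p) = 0 := by
      have hp0 : (Nat.choose 0 p : ZMod p) = 0 := by
        rw [Nat.choose_eq_zero_of_lt (by omega), Nat.cast_zero]
      simp only [card_empty, Pi.mul_apply, Pi.sub_apply, Pi.algebraMap_apply, hp0,
        Algebra.algebraMap_self, RingHom.id_apply] at h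
      push_cast
      linear_combination h
    have := Nat.le_of_dvd two_pos
      ((Fact.out : p.Prime).dvd_of_dvd_pow ((ZMod.natCast_eq_zero_iff _ _).1 h8))
    omega
  · intro I hI hne
    obtain ⟨-, ⟨k, hk⟩, hI0⟩ := by simpa only [mem_filter, mem_powerset] using hI
    have hle := card_le_univ I
    have hpos := card_pos.2 (nonempty_iff_ne_empty.2 hne)
    have hk6 : k < 6 := by
      by_contra! hk6
      have := Nat.mul_le_mul_left p hk6
      omega
    have h1 := hone I hI0
    have h3 := hthree I hI0
    have h5 := hfive I hI0
    have hk24 : k = 2 ∨ k = 4 := by interval_cases k <;> omega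
    simp only [Pi.mul_apply, Pi.sub_apply, Pi.algebraMap_apply, Algebra.algebraMap_self,
      RingHom.id_apply, hk, mul_comm p k, ZMod.choose_mul_self_eq]
    rcases hk24 with rfl | rfl <;> simp

theorem zero_sum_length_p_or_three_p (p : ℕ) (hp : p.Prime) (hodd : Odd p) :
    ∀ S : Multiset (Fin 3 → ZMod p), S.card = 6 * p - 3 →
      ∃ T : Multiset (Fin 3 → ZMod p),
        T ≤ S ∧ (T.card = p ∨ T.card = 3 * p) ∧ T.sum = 0 := by
  classical
  intro S hS
  have : Fact p.Prime := ⟨hp⟩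
  obtain ⟨I, hI, hI0⟩ := exists_zeroSum_finset_card_p_or_three_p hodd
    (fun x : S.ToType ↦ x.1) (by rw [Multiset.card_coe, hS])
  refine ⟨I.val.map fun x : S.ToType ↦ x.1, ?_, by simpa using hI, hI0⟩
  calc I.val.map (fun x : S.ToType ↦ x.1)
      ≤ (univ : Finset S.ToType).val.map fun x : S.ToType ↦ x.1 :=
        Multiset.map_le_map (val_le_iff.2 (subset_univ I))
    _ = S := Multiset.map_univ_coe S
end

section
/- Let p be a prime, let a ≤ d be positive integers, and let k be a positive integer. Then 𝔰_{≤k}((ℤ/pℤ)^d) ≤ ((p^d − 1)/(p^a − 1))·(𝔰_{≤k}((ℤ/pℤ)^a) − 1) + 1. -/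
/-- `𝔰_{≤k}(G)`: the least `t` such that every multiset of `t` elements of `G`
contains a nonempty zero-sum submultiset of length at most `k`. -/
noncomputable def sLeConstant (k : ℕ) (G : Type*) [AddCommGroup G] : ℕ :=
  sInf {t : ℕ | ∀ S : Multiset G, S.card = t →
    ∃ T : Multiset G, T ≤ S ∧ T ≠ 0 ∧ T.card ≤ k ∧ T.sum = 0}

/-- A submultiset of an image multiset is the image of a submultiset. -/
lemma Multiset.exists_le_map_eq_of_le_map {α β : Type*} (f : α → β) (S : Multiset α)
    (T : Multiset β) (h : T ≤ S.map f) : ∃ T' ≤ S, T'.map f = T := by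
  classical
  induction S using Multiset.induction_on generalizing T with
  | empty => exact ⟨0, le_rfl, by simpa [eq_comm] using h⟩
  | cons x S ih =>
    rw [Multiset.map_cons] at h
    by_cases hx : f x ∈ T
    · obtain ⟨U, rfl⟩ := Multiset.exists_cons_of_mem hx
      obtain ⟨T', hT', rfl⟩ := ih U ((Multiset.cons_le_cons_iff _).1 h)
      exact ⟨x ::ₘ T', Multiset.cons_le_cons _ hT', by simp⟩
    · obtain ⟨T', hT', rfl⟩ := ih T ((Multiset.le_cons_of_notMem hx).1 h)
      exact ⟨T', hT'.trans (Multiset.le_cons_self _ _), rfl⟩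

/-- `S` contains a nonempty zero-sum submultiset of length at most `k`. -/
def HasShortZeroSum {G : Type*} [AddCommGroup G] (k : ℕ) (S : Multiset G) : Prop :=
  ∃ T : Multiset G, T ≤ S ∧ T ≠ 0 ∧ T.card ≤ k ∧ T.sum = 0

lemma HasShortZeroSum.mono {G : Type*} [AddCommGroup G] {k : ℕ} {S S' : Multiset G}
    (h : HasShortZeroSum k S) (hS : S ≤ S') : HasShortZeroSum k S' := by
  obtain ⟨T, hT, h⟩ := h
  exact ⟨T, hT.trans hS, h⟩

/-- If `f` is injective and `f x = g (r x)` on `S`, a short zero-sum submultiset of `S.map r`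
lifts to one of `S`. -/
lemma HasShortZeroSum.of_map {G H F : Type*} [AddCommGroup G] [AddCommGroup H] [AddCommGroup F]
    {k : ℕ} {S : Multiset G} (f : G →+ F) (hf : Function.Injective f) (g : H →+ F) (r : G → H)
    (hr : ∀ x ∈ S, g (r x) = f x) (h : HasShortZeroSum k (S.map r)) : HasShortZeroSum k S := by
  obtain ⟨T, hT, hne, hcard, hsum⟩ := h
  obtain ⟨T', hT', rfl⟩ := Multiset.exists_le_map_eq_of_le_map r S T hT
  refine ⟨T', hT', by simpa using hne, by simpa using hcard, hf ?_⟩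
  have hmap : (T'.map r).map g = T'.map f := by
    rw [Multiset.map_map]
    exact Multiset.map_congr rfl fun x hx => hr x (Multiset.mem_of_le hT' hx)
  rw [map_zero, map_multiset_sum, ← hmap, ← map_multiset_sum, hsum, map_zero]

lemma hasShortZeroSum_of_sLeConstant_le {G : Type*} [AddCommGroup G] {k : ℕ}
    (hne : ∃ t, ∀ S : Multiset G, S.card = t → HasShortZeroSum k S) {S : Multiset G}
    (hS : sLeConstant k G ≤ S.card) : HasShortZeroSum k S := by
  obtain ⟨S', hS', hcard⟩ : ∃ S' ≤ S, S'.card = sLeConstant k G := by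
    induction S using Quotient.inductionOn with
    | h l => exact ⟨(l.take (sLeConstant k G) : List G), (List.take_sublist _ l).subperm,
        by simpa using hS⟩
  exact HasShortZeroSum.mono (Nat.sInf_mem hne S' hcard) hS'

open Classical in
/-- A nonzero vector of a finite field `F` is sent into the image of an injective map `H → F` by
at least `|H| - 1` units. -/
lemma card_sub_one_le_card_units_mul_mem_range {F H : Type*} [Field F] [Fintype F]
    [AddCommGroup H] (g : H →+ F) (hg : Function.Injective g) {y : F} (hy : y ≠ 0) :
    Nat.card H - 1 ≤ (Finset.univ.filter fun u : Fˣ => (u : F) * y ∈ Set.range g).card := by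
  have : Finite H := Finite.of_injective g hg
  have := Fintype.ofFinite H
  have hcard : Nat.card H - 1 = (Finset.univ.erase (0 : H)).card := by
    rw [Finset.card_erase_of_mem (Finset.mem_univ _), Finset.card_univ, Nat.card_eq_fintype_card]
  have hne : ∀ h ∈ Finset.univ.erase (0 : H), g h / y ≠ 0 := fun h hh =>
    div_ne_zero ((map_ne_zero_iff g hg).2 (Finset.ne_of_mem_erase hh)) hy
  rw [hcard]
  refine Finset.card_le_card_of_injOn (fun h => if hh : g h / y ≠ 0 then Units.mk0 _ hh else 1)
    (fun h hh => ?_) (fun h hh h' hh' heq => ?_)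
  · have := hne h hh
    simp only [dif_pos this]
    simp [div_mul_cancel₀ _ hy]
  · have h₁ := hne h hh
    have h₂ := hne h' hh'
    simp only [dif_pos h₁, dif_pos h₂] at heq
    exact hg ((div_left_inj' hy).1 (by simpa using congrArg Units.val heq))

open Classical in
/-- Double counting over all unit multiples of the image of `g`. -/
lemma card_mul_le_sum_card_filter {F G H : Type*} [Field F] [Fintype F] [AddCommGroup G]
    [AddCommGroup H] (g : H →+ F) (hg : Function.Injective g) (e : G → F) (S : Multiset G)
    (hS : ∀ x ∈ S, e x ≠ 0) :
    (Nat.card H - 1) * S.card ≤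
      ∑ u : Fˣ, (S.filter fun x => (u : F) * e x ∈ Set.range g).card := by
  induction S using Multiset.induction_on with
  | empty => simp
  | cons x S ih =>
    have hx := card_sub_one_le_card_units_mul_mem_range g hg (hS x (Multiset.mem_cons_self x S))
    have hS' := ih fun y hy => hS y (Multiset.mem_cons_of_mem hy)
    simp only [← Multiset.countP_eq_card_filter, Multiset.countP_cons, Finset.sum_add_distrib,
      Multiset.card_cons, mul_add, mul_one, Finset.sum_boole, Nat.cast_id] at hS' ⊢
    exact add_le_add hS' hx

theorem sLe_lift (p a d k : ℕ) (hp : p.Prime) (ha : 0 < a) (had : a ≤ d) (hk : 0 < k) :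
    (p ^ a - 1) * (sLeConstant k (Fin d → ZMod p) - 1) ≤
      (p ^ d - 1) * (sLeConstant k (Fin a → ZMod p) - 1) := by
  classical
  have : Fact p.Prime := ⟨hp⟩
  have hd : d ≠ 0 := by omega
  rcases Nat.eq_zero_or_pos (sLeConstant k (Fin d → ZMod p)) with h0 | hpos
  · simp [h0]
  let F := GaloisField p d
  have : Fintype F := Fintype.ofFinite F
  let e : (Fin d → ZMod p) ≃ₗ[ZMod p] F :=
    LinearEquiv.ofFinrankEq _ _ (by simp [F, GaloisField.finrank p hd])
  let j : (Fin a → ZMod p) →ₗ[ZMod p] (Fin d → ZMod p) :=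
    Function.ExtendByZero.linearMap (ZMod p) (Fin.castLE had)
  have hj : Function.Injective j := fun x y hxy => by
    funext i
    simpa [j, (Fin.castLE_injective had).extend_apply] using congrFun hxy (Fin.castLE had i)
  let g : (Fin a → ZMod p) →+ F := (e.toLinearMap ∘ₗ j).toAddMonoidHom
  have hg : Function.Injective g := e.injective.comp hj
  have hne : ∃ t, ∀ S : Multiset (Fin a → ZMod p), S.card = t → HasShortZeroSum k S := by
    obtain ⟨t, ht⟩ := Nat.nonempty_of_pos_sInf hpos
    exact ⟨t, fun S hS => HasShortZeroSum.of_map j.toAddMonoidHom hj (AddMonoidHom.id _) j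
      (fun _ _ => rfl) (ht _ (by simpa using hS))⟩
  obtain ⟨S, hcard, hfree⟩ : ∃ S : Multiset (Fin d → ZMod p),
      S.card = sLeConstant k (Fin d → ZMod p) - 1 ∧ ¬ HasShortZeroSum k S := by
    by_contra! hall
    exact Nat.notMem_of_lt_sInf (Nat.sub_lt hpos one_pos) hall
  have hS : ∀ x ∈ S, e x ≠ 0 := fun x hx h => hfree
    ⟨{x}, Multiset.singleton_le.2 hx, by simp, by simpa using Nat.succ_le_of_lt hk, by simpa using h⟩
  have hbound (u : Fˣ) : (S.filter fun x => (u : F) * e x ∈ Set.range g).card ≤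
      sLeConstant k (Fin a → ZMod p) - 1 := by
    by_contra! hlt
    refine hfree (HasShortZeroSum.mono ?_
      (Multiset.filter_le (fun x => (u : F) * e x ∈ Set.range g) S))
    refine HasShortZeroSum.of_map ((AddMonoidHom.mulLeft (u : F)).comp e.toLinearMap.toAddMonoidHom)
      ((mul_right_injective₀ u.ne_zero).comp e.injective) g
      (fun x => Function.invFun g ((u : F) * e x))
      (fun x hx => Function.invFun_eq (Multiset.mem_filter.1 hx).2)
      (hasShortZeroSum_of_sLeConstant_le hne ?_)
    rw [Multiset.card_map]
    omega
  calc (p ^ a - 1) * (sLeConstant k (Fin d → ZMod p) - 1)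
      = (Nat.card (Fin a → ZMod p) - 1) * S.card := by simp [hcard]
    _ ≤ ∑ u : Fˣ, (S.filter fun x => (u : F) * e x ∈ Set.range g).card := by
      convert card_mul_le_sum_card_filter g hg e S hS
    _ ≤ ∑ _u : Fˣ, (sLeConstant k (Fin a → ZMod p) - 1) := Finset.sum_le_sum fun u _ => hbound u
    _ = (p ^ d - 1) * (sLeConstant k (Fin a → ZMod p) - 1) := by
      rw [Finset.sum_const, smul_eq_mul, Finset.card_univ, Fintype.card_units,
        ← Nat.card_eq_fintype_card, GaloisField.card p d hd]
end

section
/- Let p be an odd prime and k a positive integer. Then D_k((ℤ/pℤ)^3) ≤ max(5p − 2, (3(p − 1)/2)·k + 2p + 5); that is, every sequence over (ℤ/pℤ)^3 of length at least this maximum contains k pairwise disjoint nonempty zero-sum subsequences. -/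
/-- `D_k(G)`: the least `t` such that every multiset of `t` elements of `G` contains
`k` pairwise disjoint nonempty zero-sum submultisets. -/
noncomputable def disjointZeroSumConstant (k : ℕ) (G : Type*) [AddCommGroup G] : ℕ :=
  sInf {t : ℕ | ∀ S : Multiset G, S.card = t →
    ∃ L : Multiset (Multiset G), L.card = k ∧ L.sum ≤ S ∧ ∀ T ∈ L, T ≠ 0 ∧ T.sum = 0}

open Finset AddMonoidAlgebra

/-- `DegreeLT d f` says that the `d`-fold forward difference of `f` vanishes identically. -/
def DegreeLT {R : Type*} [CommRing R] : ℕ → (ℕ → R) → Prop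
  | 0, f => ∀ n, f n = 0
  | d + 1, f => DegreeLT d fun n => f (n + 1) - f n

namespace DegreeLT

variable {R : Type*} [CommRing R]

theorem congr {d : ℕ} {f g : ℕ → R} (hf : DegreeLT d f) (h : ∀ n, f n = g n) : DegreeLT d g :=
  (funext h : f = g) ▸ hf

theorem zero (d : ℕ) : DegreeLT d fun _ => (0 : R) := by
  induction d with
  | zero => exact fun _ => rfl
  | succ d ih => exact ih.congr fun _ => (sub_self _).symm

theorem succ {d : ℕ} {f : ℕ → R} (hf : DegreeLT d f) : DegreeLT (d + 1) f := by
  induction d generalizing f with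
  | zero => exact fun n => by simp [hf n, hf (n + 1)]
  | succ d ih => exact ih hf

theorem mono {d e : ℕ} {f : ℕ → R} (hf : DegreeLT d f) (h : d ≤ e) : DegreeLT e f := by
  induction h with
  | refl => exact hf
  | step _ ih => exact ih.succ

theorem shift {d : ℕ} {f : ℕ → R} (hf : DegreeLT d f) : DegreeLT d fun n => f (n + 1) := by
  induction d generalizing f with
  | zero => exact fun n => hf (n + 1)
  | succ d ih => exact ih hf

theorem add {d : ℕ} {f g : ℕ → R} (hf : DegreeLT d f) (hg : DegreeLT d g) :
    DegreeLT d fun n => f n + g n := by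
  induction d generalizing f g with
  | zero => exact fun n => by simp [hf n, hg n]
  | succ d ih => exact (ih hf hg).congr fun n => by ring

theorem neg {d : ℕ} {f : ℕ → R} (hf : DegreeLT d f) : DegreeLT d fun n => - f n := by
  induction d generalizing f with
  | zero => exact fun n => by simp [hf n]
  | succ d ih => exact (ih hf).congr fun n => by ring

theorem sub {d : ℕ} {f g : ℕ → R} (hf : DegreeLT d f) (hg : DegreeLT d g) :
    DegreeLT d fun n => f n - g n :=
  (hf.add hg.neg).congr fun n => by ring

theorem mul {a b N : ℕ} {f g : ℕ → R} (hf : DegreeLT a f) (hg : DegreeLT b g)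
    (h : a + b ≤ N + 1) : DegreeLT N fun n => f n * g n := by
  induction N generalizing a b f g with
  | zero =>
    intro n
    rcases Nat.eq_zero_or_pos a with rfl | ha
    · simp [show f n = 0 from hf n]
    · obtain rfl : b = 0 := by omega
      simp [show g n = 0 from hg n]
  | succ N ih =>
    rcases a with _ | a
    · exact (zero _).congr fun n => by simp [show f n = 0 from hf n]
    rcases b with _ | b
    · exact (zero _).congr fun n => by simp [show g n = 0 from hg n]
    have h₁ := ih (a := a) (b := b + 1) hf hg.shift (by omega)
    have h₂ := ih (a := a + 1) (b := b) hf hg (by omega)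
    exact (h₁.add h₂).congr fun n => by ring

theorem const (c : R) : DegreeLT 1 fun _ => c := fun _ => sub_self c

theorem natCast : DegreeLT 2 fun n => (n : R) := fun n => by push_cast; ring

theorem natCast_pow (m : ℕ) : DegreeLT (m + 1) fun n => (n : R) ^ m := by
  induction m with
  | zero => exact (const 1).congr fun n => by simp
  | succ m ih => exact (ih.mul natCast (by omega)).congr fun n => by ring

theorem choose (m : ℕ) : DegreeLT (m + 1) fun n => (n.choose m : R) := by
  induction m with
  | zero => exact (const 1).congr fun n => by simp
  | succ m ih =>
    change DegreeLT (m + 1) fun n => ((n + 1).choose (m + 1) : R) - (n.choose (m + 1) : R)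
    exact ih.congr fun n => by rw [Nat.choose_succ_succ]; push_cast; ring

theorem prod_natCast_sub (t : Finset ℕ) :
    DegreeLT (t.card + 1) fun n => ∏ c ∈ t, ((n : R) - c) := by
  induction t using Finset.induction with
  | empty => exact (const 1).congr fun n => by simp
  | insert c t hc ih =>
    rw [card_insert_of_notMem hc]
    exact ((natCast.sub (const (c : R)).succ).mul ih (by omega)).congr fun n => by
      rw [prod_insert hc]

end DegreeLT

section GroupAlgebra

variable {p : ℕ} {ι : Type*} [DecidableEq ι]

/-- The augmentation ideal of the group algebra of `(ℤ/pℤ)³` over `ℤ/pℤ`. -/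
noncomputable def augIdeal (p : ℕ) : Ideal (AddMonoidAlgebra (ZMod p) (Fin 3 → ZMod p)) :=
  Ideal.span (Set.range fun x => single x 1 - 1)

theorem single_sub_one_mem (x : Fin 3 → ZMod p) : single x 1 - 1 ∈ augIdeal p :=
  Ideal.subset_span ⟨x, rfl⟩

theorem single_eq_prod_basis [NeZero p] (x : Fin 3 → ZMod p) :
    (single x 1 : AddMonoidAlgebra (ZMod p) (Fin 3 → ZMod p)) =
      ∏ k, single (Pi.single k 1) 1 ^ (x k).val := by
  simp only [single_pow, prod_single, one_pow, prod_const_one]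
  congr 1
  ext j
  simp [Finset.sum_apply, Pi.smul_apply, Pi.single_apply, -nsmul_eq_mul,
    ← Nat.cast_smul_eq_nsmul (ZMod p)]

theorem augIdeal_eq_span_basis [NeZero p] :
    augIdeal p = Ideal.span (Set.range fun k : Fin 3 => single (Pi.single k 1) 1 - 1) := by
  apply le_antisymm
  · rw [augIdeal, Ideal.span_le]
    rintro _ ⟨x, rfl⟩
    rw [SetLike.mem_coe, ← Ideal.Quotient.eq]
    rw [single_eq_prod_basis, map_prod]
    simp only [map_pow]
    rw [map_one]
    refine prod_eq_one fun k _ => ?_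
    have hk : Ideal.Quotient.mk (Ideal.span (Set.range fun k : Fin 3 =>
        (single (Pi.single k 1) 1 - 1 : AddMonoidAlgebra (ZMod p) (Fin 3 → ZMod p))))
        (single (Pi.single k 1) 1) = Ideal.Quotient.mk _ 1 :=
      Ideal.Quotient.eq.2 (Ideal.subset_span ⟨k, rfl⟩)
    rw [hk, map_one, one_pow]
  · rw [Ideal.span_le]
    rintro _ ⟨k, rfl⟩
    exact single_sub_one_mem _

theorem pow_prime_eq_zero_of_mem_augIdeal [Fact p.Prime]
    {x : AddMonoidAlgebra (ZMod p) (Fin 3 → ZMod p)} (hx : x ∈ augIdeal p) : x ^ p = 0 := by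
  have : CharP (AddMonoidAlgebra (ZMod p) (Fin 3 → ZMod p)) p :=
    charP_of_injective_algebraMap (algebraMap (ZMod p) _).injective p
  rw [← frobenius_def, ← RingHom.mem_ker]
  revert x
  change augIdeal p ≤ _
  rw [augIdeal, Ideal.span_le]
  rintro _ ⟨x, rfl⟩
  rw [SetLike.mem_coe, RingHom.mem_ker, frobenius_def, sub_pow_char, single_pow]
  simp [one_def, ← Nat.cast_smul_eq_nsmul (ZMod p)]

theorem sup_pow_le_bot {R : Type*} [CommRing R] {I J : Ideal R} {m n N : ℕ}
    (hI : I ^ m ≤ ⊥) (hJ : J ^ n ≤ ⊥) (h : m + n ≤ N + 1) : (I ⊔ J) ^ N ≤ ⊥ := by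
  rw [← Ideal.add_eq_sup, add_pow, Ideal.sum_eq_sup]
  refine Finset.sup_le fun i _ => Ideal.mul_le_left.trans ?_
  by_cases hi : m ≤ i
  · exact Ideal.mul_le_left.trans ((Ideal.pow_le_pow_right hi).trans hI)
  · exact Ideal.mul_le_right.trans ((Ideal.pow_le_pow_right (by omega)).trans hJ)

theorem augIdeal_pow_eq_bot [Fact p.Prime] : augIdeal p ^ (3 * p - 2) = ⊥ := by
  have h0 (k : Fin 3) : Ideal.span {(single (Pi.single k 1) 1 - 1 :
      AddMonoidAlgebra (ZMod p) (Fin 3 → ZMod p))} ^ p ≤ ⊥ := by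
    rw [Ideal.span_singleton_pow, pow_prime_eq_zero_of_mem_augIdeal (single_sub_one_mem _)]
    simp
  rw [eq_bot_iff, augIdeal_eq_span_basis, Ideal.span_range_eq_iSup]
  have hp := (Fact.out : p.Prime).two_le
  have h := sup_pow_le_bot (h0 0) (sup_pow_le_bot (h0 1) (h0 2) (N := 2 * p - 1) (by omega))
    (N := 3 * p - 2) (by omega)
  refine le_trans (Ideal.pow_right_mono (iSup_le fun k => ?_) _) h
  fin_cases k
  · exact le_sup_left
  · exact le_sup_left.trans le_sup_right
  · exact le_sup_right.trans le_sup_right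

theorem sum_powerset_signed_mem_augIdeal_pow (g : ι → Fin 3 → ZMod p) (s : Finset ι) {d m : ℕ}
    {f : ℕ → ZMod p} (hf : DegreeLT d f) (h : m + d ≤ s.card + 1) :
    ∑ B ∈ s.powerset, single (∑ i ∈ B, g i) ((-1) ^ B.card * f B.card) ∈ augIdeal p ^ m := by
  induction s using Finset.induction generalizing d m f with
  | empty =>
    rcases m with _ | m
    · simp
    · obtain rfl : d = 0 := by simp at h; omega
      simp [show f 0 = 0 from hf 0]
  | insert x s hx ih =>
    rcases m with _ | m
    · simp
    rcases d with _ | d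
    · simp [show ∀ n, f n = 0 from hf]
    rw [card_insert_of_notMem hx] at h
    have h₁ := ih (m := m) hf (by omega)
    have h₂ := ih (m := m + 1) (d := d) hf (by omega)
    have h₃ := Ideal.mul_mem_mul h₁ (single_sub_one_mem (g x))
    rw [← pow_succ] at h₃
    have h₄ := sub_mem (neg_mem h₃) (Ideal.mul_mem_right (single (g x) 1) _ h₂)
    convert h₄ using 1
    rw [sum_powerset_insert hx, mul_sub, mul_one, sum_mul, sum_mul, neg_sub, sub_sub,
      ← sum_add_distrib, ← sum_add_distrib, ← sum_sub_distrib]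
    refine sum_congr rfl fun B hB => ?_
    have hxB : x ∉ B := fun h => hx (mem_powerset.1 hB h)
    rw [sum_insert hxB, card_insert_of_notMem hxB, single_mul_single, single_mul_single,
      ← single_add, add_comm (g x), sub_eq_add_neg, ← single_neg]
    congr 2
    ring

theorem exists_zero_sum_of_degreeLT [Fact p.Prime] (g : ι → Fin 3 → ZMod p) (s : Finset ι) {d : ℕ}
    {f : ℕ → ZMod p} (hf : DegreeLT d f) (h : 3 * p - 2 + d ≤ s.card + 1) (h0 : f 0 ≠ 0) :
    ∃ B ⊆ s, B.Nonempty ∧ ∑ i ∈ B, g i = 0 ∧ f B.card ≠ 0 := by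
  by_contra! hcon
  have hmem := sum_powerset_signed_mem_augIdeal_pow g s hf h
  rw [augIdeal_pow_eq_bot, Ideal.mem_bot] at hmem
  have hc := congrArg (fun a => a.coeff 0) hmem
  simp only [coeff_sum, coeff_single, Finsupp.finsetSum_apply, coeff_zero, Finsupp.zero_apply] at hc
  rw [sum_eq_single ∅] at hc
  · simp [h0] at hc
  · intro B hB hne
    rw [Finsupp.single_apply]
    split_ifs with h1
    · rw [hcon B (mem_powerset.1 hB) (nonempty_iff_ne_empty.2 hne) h1, mul_zero]
    · rfl
  · simp

end GroupAlgebra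

section ZeroSum

variable {p : ℕ} {ι : Type*} [DecidableEq ι]

theorem cast_choose_prime_eq_div [Fact p.Prime] (n : ℕ) :
    (n.choose p : ZMod p) = ((n / p : ℕ) : ZMod p) := by
  have h := Choose.choose_modEq_choose_mod_mul_choose_div_nat (n := n) (k := p) (p := p)
  have hp := (Fact.out : p.Prime).pos
  rw [Nat.mod_self, Nat.div_self hp, Nat.choose_zero_right, Nat.choose_one_right, one_mul] at h
  exact (ZMod.natCast_eq_natCast_iff _ _ _).2 h

theorem two_ne_zero_zmod [Fact p.Prime] (hodd : Odd p) : (2 : ZMod p) ≠ 0 := by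
  have h : ((2 : ℕ) : ZMod p) ≠ 0 := by
    rw [Ne, ZMod.natCast_eq_zero_iff, Nat.prime_dvd_prime_iff_eq Fact.out Nat.prime_two]
    rintro rfl
    exact absurd hodd (by decide)
  exact_mod_cast h

theorem exists_zero_sum [Fact p.Prime] (g : ι → Fin 3 → ZMod p) {s : Finset ι}
    (h : 3 * p - 2 ≤ s.card) : ∃ B ⊆ s, B.Nonempty ∧ ∑ i ∈ B, g i = 0 := by
  obtain ⟨B, hB, hne, h0, -⟩ :=
    exists_zero_sum_of_degreeLT g s (DegreeLT.const 1) (by omega) one_ne_zero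
  exact ⟨B, hB, hne, h0⟩

theorem dvd_of_one_sub_pow_ne_zero [Fact p.Prime] {n : ℕ} (h : 1 - (n : ZMod p) ^ (p - 1) ≠ 0) :
    p ∣ n := by
  rw [← ZMod.natCast_eq_zero_iff]
  by_contra hn
  exact h (by rw [ZMod.pow_card_sub_one_eq_one hn, sub_self])

theorem degreeLT_one_sub_pow [Fact p.Prime] :
    DegreeLT p fun n => 1 - (n : ZMod p) ^ (p - 1) := by
  have hp := (Fact.out : p.Prime).pos
  have h := ((DegreeLT.const (1 : ZMod p)).mono (e := p - 1 + 1) (by omega)).sub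
    (DegreeLT.natCast_pow (p - 1))
  rwa [Nat.sub_add_cancel hp] at h

theorem degreeLT_choose_sub [Fact p.Prime] (c : ZMod p) :
    DegreeLT (p + 1) fun n => (n.choose p : ZMod p) - c :=
  (DegreeLT.choose p).sub ((DegreeLT.const c).mono (by omega))

theorem exists_zero_sum_dvd_card [Fact p.Prime] (g : ι → Fin 3 → ZMod p) {s : Finset ι}
    (h : 4 * p - 3 ≤ s.card) : ∃ B ⊆ s, B.Nonempty ∧ ∑ i ∈ B, g i = 0 ∧ p ∣ B.card := by
  have hp := (Fact.out : p.Prime).two_le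
  obtain ⟨B, hB, hne, h0, h1⟩ := exists_zero_sum_of_degreeLT g s degreeLT_one_sub_pow (by omega)
    (by simp [show p - 1 ≠ 0 by omega])
  exact ⟨B, hB, hne, h0, dvd_of_one_sub_pow_ne_zero h1⟩

theorem sum_sdiff_eq_zero {g : ι → Fin 3 → ZMod p} {B C : Finset ι} (hC : C ⊆ B)
    (hB0 : ∑ i ∈ B, g i = 0) (hC0 : ∑ i ∈ C, g i = 0) : ∑ i ∈ B \ C, g i = 0 := by
  rw [← sum_sdiff hC, hC0, add_zero] at hB0
  exact hB0

/-- `HasDisjointZeroSums g k s` says that `s` contains `k` pairwise disjoint nonempty subsets over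
each of which `g` sums to zero. -/
def HasDisjointZeroSums {G : Type*} [AddCommGroup G] (g : ι → G) : ℕ → Finset ι → Prop
  | 0, _ => True
  | k + 1, s => ∃ B ⊆ s, B.Nonempty ∧ ∑ i ∈ B, g i = 0 ∧ HasDisjointZeroSums g k (s \ B)

theorem exists_zero_sum_ssubset [Fact p.Prime] {g : ι → Fin 3 → ZMod p} {B : Finset ι}
    (hB0 : ∑ i ∈ B, g i = 0) (h : 3 * p - 1 ≤ B.card) :
    ∃ C ⊆ B, C.Nonempty ∧ ∑ i ∈ C, g i = 0 ∧ (B \ C).Nonempty ∧ ∑ i ∈ B \ C, g i = 0 := by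
  have hp := (Fact.out : p.Prime).two_le
  obtain ⟨x, hx⟩ : B.Nonempty := card_pos.1 (by omega)
  obtain ⟨C, hC, hne, h0⟩ := exists_zero_sum g (s := B.erase x) (by
    rw [card_erase_of_mem hx]; omega)
  have hCB := hC.trans (erase_subset x B)
  exact ⟨C, hCB, hne, h0, ⟨x, mem_sdiff.2 ⟨hx, fun h => notMem_erase x B (hC h)⟩⟩,
    sum_sdiff_eq_zero hCB hB0 h0⟩

variable {q : ℕ}

theorem hasDisjointZeroSums_two [Fact p.Prime] (hq : p = 2 * q + 1) (g : ι → Fin 3 → ZMod p)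
    {s : Finset ι} (h : 9 * q + 2 ≤ s.card) : HasDisjointZeroSums g 2 s := by
  have hp := (Fact.out : p.Prime).two_le
  by_cases hshort : ∃ B ⊆ s, B.Nonempty ∧ ∑ i ∈ B, g i = 0 ∧ B.card ≤ 3 * q + 1
  · obtain ⟨B, hB, hne, h0, hc⟩ := hshort
    refine ⟨B, hB, hne, h0, ?_⟩
    obtain ⟨C, hC, hne', h0'⟩ := exists_zero_sum g (s := s \ B) (by
      rw [card_sdiff_of_subset hB]; omega)
    exact ⟨C, hC, hne', h0', trivial⟩
  push Not at hshort
  have h2 := two_ne_zero_zmod (p := p) ⟨q, hq⟩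
  obtain ⟨B, hB, hne, h0, h1⟩ := exists_zero_sum_of_degreeLT g s
    ((degreeLT_choose_sub (p := p) 2).mul (DegreeLT.prod_natCast_sub (Icc (q + 1) (2 * q)))
      (N := p + q + 1) (by simp; omega)) (by omega) (by
      refine mul_ne_zero (by simpa [Nat.choose_eq_zero_of_lt (show 0 < p by omega)] using h2) ?_
      refine prod_ne_zero_iff.2 fun c hc => ?_
      rw [mem_Icc] at hc
      rw [Nat.cast_zero, zero_sub, neg_ne_zero, Ne, ZMod.natCast_eq_zero_iff]
      exact fun hd => absurd (Nat.le_of_dvd (by omega) hd) (by omega))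
  have hl := hshort B hB hne h0
  by_cases hlong : 3 * p - 1 ≤ B.card
  · obtain ⟨C, hC, hCne, hC0, hDne, hD0⟩ := exists_zero_sum_ssubset h0 hlong
    exact ⟨C, hC.trans hB, hCne, hC0, B \ C, sdiff_subset_sdiff hB le_rfl, hDne, hD0, trivial⟩
  · exfalso
    apply h1
    rcases Nat.lt_or_ge B.card (2 * p) with hlt | hge
    · refine mul_eq_zero_of_right _ (prod_eq_zero (i := B.card - p) (mem_Icc.2 (by omega)) ?_)
      rw [Nat.cast_sub (by omega), CharP.cast_eq_zero (ZMod p) p, sub_zero, sub_self]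
    · refine mul_eq_zero_of_left ?_ _
      rw [cast_choose_prime_eq_div, Nat.div_eq_of_lt_le (k := 2) (by omega) (by omega)]
      simp

theorem exists_zero_sum_card_le [Fact p.Prime] (hq : p = 2 * q + 1) (g : ι → Fin 3 → ZMod p)
    {s : Finset ι} (h : 12 * q + 3 ≤ s.card) :
    ∃ B ⊆ s, B.Nonempty ∧ ∑ i ∈ B, g i = 0 ∧ B.card ≤ 3 * q + 1 := by
  have hp := (Fact.out : p.Prime).two_le
  have h2 := two_ne_zero_zmod (p := p) ⟨q, hq⟩
  obtain ⟨s', hs', hcard⟩ := exists_subset_card_eq h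
  by_contra! hcon
  replace hcon (B) (hB : B ⊆ s') (hne : B.Nonempty) (h0 : ∑ i ∈ B, g i = 0)
      : 3 * q + 1 < B.card :=
    hcon B (hB.trans hs') hne h0
  have hthree (B) (hB : B ⊆ s') (h0 : ∑ i ∈ B, g i = 0) : B.card ≠ p * 3 := by
    intro hc
    obtain ⟨C, hC, hCne, hC0, hDne, hD0⟩ := exists_zero_sum_ssubset h0 (by omega)
    have h1 := hcon C (hC.trans hB) hCne hC0
    have h2 := hcon (B \ C) (sdiff_subset.trans hB) hDne hD0
    rw [card_sdiff_of_subset hC] at h2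
    omega
  have hfive (B) (hB : B ⊆ s') (h0 : ∑ i ∈ B, g i = 0) : B.card ≠ p * 5 := by
    intro hc
    obtain ⟨x, hx⟩ : B.Nonempty := card_pos.1 (by omega)
    have hce := card_erase_of_mem hx
    obtain ⟨C, hC, hne, hC0, m, hm⟩ := exists_zero_sum_dvd_card g (s := B.erase x) (by omega)
    have hCB := hC.trans (erase_subset x B)
    have hle := card_le_card hC
    have hC1 := hcon C (hCB.trans hB) hne hC0
    have hC3 := hthree C (hCB.trans hB) hC0
    have hD0 := sum_sdiff_eq_zero hCB h0 hC0
    have hDc := card_sdiff_of_subset hCB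
    have hD1 := hcon (B \ C) (sdiff_subset.trans hB) (card_pos.1 (by omega)) hD0
    have hD3 := hthree (B \ C) (sdiff_subset.trans hB) hD0
    have hm5 : m < 5 := lt_of_mul_lt_mul_left (a := p) (by omega) (by omega)
    interval_cases m <;> omega
  obtain ⟨B, hB, hne, h0, h1⟩ := exists_zero_sum_of_degreeLT g s'
    ((degreeLT_one_sub_pow.mul (degreeLT_choose_sub (p := p) 2) (N := 2 * p) (by omega)).mul
      (degreeLT_choose_sub (p := p) 4) (N := 3 * p) (by omega)) (by omega) (by
      have h4 : (4 : ZMod p) ≠ 0 := by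
        rw [show (4 : ZMod p) = 2 * 2 by norm_num]
        exact mul_ne_zero h2 h2
      simp [Nat.choose_eq_zero_of_lt (show 0 < p by omega), show p - 1 ≠ 0 by omega, h2, h4])
  obtain ⟨m, hm⟩ := dvd_of_one_sub_pow_ne_zero (left_ne_zero_of_mul (left_ne_zero_of_mul h1))
  have hm2 := right_ne_zero_of_mul (left_ne_zero_of_mul h1)
  have hm4 := right_ne_zero_of_mul h1
  rw [cast_choose_prime_eq_div, hm, Nat.mul_div_cancel_left _ (by omega)] at hm2 hm4
  have hle := card_le_card hB
  have hB1 := hcon B hB hne h0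
  have hB3 := hthree B hB h0
  have hB5 := hfive B hB h0
  have hm6 : m < 6 := lt_of_mul_lt_mul_left (a := p) (by omega) (by omega)
  interval_cases m
  · omega
  · omega
  · simp at hm2
  · omega
  · simp at hm4
  · omega

theorem exists_zero_sum_card_eq_prime [Fact p.Prime] (hodd : Odd p) (g : ι → Fin 3 → ZMod p)
    {s : Finset ι} (h : 4 * p - 2 ≤ s.card)
    (hdvd : ∀ B ⊆ s, ∑ i ∈ B, g i = 0 → p ∣ B.card) :
    ∃ B ⊆ s, ∑ i ∈ B, g i = 0 ∧ B.card = p := by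
  have hp := (Fact.out : p.Prime).two_le
  have h2 := two_ne_zero_zmod hodd
  obtain ⟨s', hs', hcard⟩ := exists_subset_card_eq h
  by_contra! hcon
  obtain ⟨B, hB, hne, h0, h1⟩ := exists_zero_sum_of_degreeLT g s'
    (degreeLT_choose_sub (p := p) 2) (by omega) (by
      simpa [Nat.choose_eq_zero_of_lt (show 0 < p by omega)] using h2)
  have hBs := hB.trans hs'
  obtain ⟨m, hm⟩ := hdvd B hBs h0
  rw [cast_choose_prime_eq_div, hm, Nat.mul_div_cancel_left _ (by omega)] at h1
  have hle := card_le_card hB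
  have hm4 : m < 4 := lt_of_mul_lt_mul_left (a := p) (by omega) (by omega)
  have hpos := hne.card_pos
  interval_cases m
  · omega
  · exact hcon B hBs h0 (by omega)
  · simp at h1
  · obtain ⟨x, hx⟩ := hne
    have hce := card_erase_of_mem hx
    obtain ⟨C, hC, hCne, hC0⟩ := exists_zero_sum g (s := B.erase x) (by omega)
    have hCB := hC.trans (erase_subset x B)
    have hCle := card_le_card hC
    have hCpos := hCne.card_pos
    obtain ⟨n, hn⟩ := hdvd C (hCB.trans hBs) hC0
    have hn3 : n < 3 := lt_of_mul_lt_mul_left (a := p) (by omega) (by omega)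
    have hC1 := hcon C (hCB.trans hBs) hC0
    have hD1 := hcon (B \ C) (sdiff_subset.trans hBs) (sum_sdiff_eq_zero hCB h0 hC0)
    rw [card_sdiff_of_subset hCB] at hD1
    interval_cases n <;> omega

theorem hasDisjointZeroSums_of_card_ge [Fact p.Prime] (hq : p = 2 * q + 1)
    (g : ι → Fin 3 → ZMod p) {k : ℕ} (hk : 0 < k) {s : Finset ι}
    (h : (3 * q + 1) * k + 3 * q ≤ s.card) : HasDisjointZeroSums g k s := by
  induction k, hk using Nat.le_induction generalizing s with
  | base =>
    obtain ⟨B, hB, hne, h0⟩ := exists_zero_sum g (s := s) (by omega)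
    exact ⟨B, hB, hne, h0, trivial⟩
  | succ k hk ih =>
    rcases hk.eq_or_lt with rfl | hk2
    · exact hasDisjointZeroSums_two hq g (by omega)
    · obtain ⟨B, hB, hne, h0, hc⟩ := exists_zero_sum_card_le hq g (s := s) (by nlinarith)
      refine ⟨B, hB, hne, h0, ih ?_⟩
      rw [card_sdiff_of_subset hB]
      rw [mul_add] at h
      omega

end ZeroSum

section Blocks

variable {p : ℕ} {ι : Type*} [DecidableEq ι]

theorem mk_mul_mul_eq_zero {x y z : AddMonoidAlgebra (ZMod p) (Fin 3 → ZMod p)}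
    (hx : x ∈ augIdeal p) (hy : y ∈ augIdeal p) (hz : z ∈ augIdeal p) :
    (Ideal.Quotient.mk (augIdeal p ^ 3) x) * (Ideal.Quotient.mk (augIdeal p ^ 3) y *
      Ideal.Quotient.mk (augIdeal p ^ 3) z) = 0 := by
  rw [← map_mul, ← map_mul, Ideal.Quotient.eq_zero_iff_mem, pow_succ', pow_two]
  exact Ideal.mul_mem_mul hx (Ideal.mul_mem_mul hy hz)

theorem finrank_quotient_augIdeal_cube_le [Fact p.Prime] :
    Module.finrank (ZMod p)
      (AddMonoidAlgebra (ZMod p) (Fin 3 → ZMod p) ⧸ augIdeal p ^ 3) ≤ 10 := by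
  let π := Ideal.Quotient.mk (augIdeal p ^ 3)
  let ε : Fin 3 → AddMonoidAlgebra (ZMod p) (Fin 3 → ZMod p) :=
    fun k => single (Pi.single k 1) 1 - 1
  have hε (k) : ε k ∈ augIdeal p := single_sub_one_mem _
  let v : Fin 4 → AddMonoidAlgebra (ZMod p) (Fin 3 → ZMod p) ⧸ augIdeal p ^ 3 :=
    Fin.cons 1 fun k => π (ε k)
  let F : Sym2 (Fin 4) → AddMonoidAlgebra (ZMod p) (Fin 3 → ZMod p) ⧸ augIdeal p ^ 3 :=
    Sym2.lift ⟨fun i j => v i * v j, fun i j => mul_comm _ _⟩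
  let M := Submodule.span (ZMod p) (Set.range F)
  have hF (i j) : v i * v j ∈ M := Submodule.subset_span ⟨s(i, j), rfl⟩
  have hmul (k : Fin 3) {y} (hy : y ∈ M) : y * π (single (Pi.single k 1) 1) ∈ M := by
    have h1 : y * π (ε k) ∈ M := by
      induction hy using Submodule.span_induction with
      | mem y hy =>
        obtain ⟨z, rfl⟩ := hy
        induction z using Sym2.ind with
        | _ i j =>
          change v i * v j * v k.succ ∈ M
          refine Fin.cases ?_ (fun i => ?_) i
          · simpa [v] using hF j k.succ
          refine Fin.cases ?_ (fun j => ?_) j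
          · simpa [v] using hF i.succ k.succ
          · have : v i.succ * v j.succ * v k.succ = 0 := by
              rw [mul_assoc]
              exact mk_mul_mul_eq_zero (hε i) (hε j) (hε k)
            rw [this]
            exact zero_mem _
      | zero => simp
      | add x y _ _ hx hy => rw [add_mul]; exact add_mem hx hy
      | smul a x _ hx => rw [smul_mul_assoc]; exact M.smul_mem a hx
    have h2 : π (single (Pi.single k 1) 1) = π (ε k) + 1 := by simp [ε]
    rw [h2, mul_add, mul_one]
    exact add_mem h1 hy
  have hmulpow (k : Fin 3) (n : ℕ) {y} (hy : y ∈ M) :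
      y * π (single (Pi.single k 1) 1) ^ n ∈ M := by
    induction n with
    | zero => simpa using hy
    | succ n ih => rw [_root_.pow_succ (π _), ← mul_assoc]; exact hmul k ih
  have hsingle (x : Fin 3 → ZMod p) : π (single x 1) ∈ M := by
    rw [single_eq_prod_basis, map_prod, Fin.prod_univ_three]
    simp only [map_pow]
    refine hmulpow _ _ (hmulpow _ _ ?_)
    rw [← one_mul (π _ ^ _)]
    exact hmulpow _ _ (by simpa [v] using hF 0 0)
  have htop : M = ⊤ := by
    rw [eq_top_iff]
    rintro y -
    obtain ⟨a, rfl⟩ := Ideal.Quotient.mk_surjective y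
    induction a using AddMonoidAlgebra.induction_linear with
    | zero => simp
    | add a b ha hb => rw [map_add]; exact add_mem ha hb
    | single x c =>
      have h := M.smul_mem c (hsingle x)
      rw [← mul_one c, ← smul_eq_mul, ← smul_single]
      exact h
  rw [← finrank_top, ← htop]
  refine (finrank_range_le_card F).trans ?_
  rw [Sym2.card]
  decide

theorem exists_subset_card_le_ten_span_eq [Fact p.Prime]
    (w : ι → AddMonoidAlgebra (ZMod p) (Fin 3 → ZMod p) ⧸ augIdeal p ^ 3) (R : Finset ι) :
    ∃ B ⊆ R, B.card ≤ 10 ∧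
      Submodule.span (ZMod p) (w '' B) = Submodule.span (ZMod p) (w '' R) := by
  have : Module.Finite (ZMod p)
      (AddMonoidAlgebra (ZMod p) (Fin 3 → ZMod p) ⧸ augIdeal p ^ 3) :=
    Module.Finite.of_surjective (Ideal.Quotient.mkₐ (ZMod p) (augIdeal p ^ 3)).toLinearMap
      Ideal.Quotient.mk_surjective
  obtain ⟨f, hf, hspan, -⟩ := Submodule.exists_fun_fin_finrank_span_eq (ZMod p) (w '' (R : Set ι))
  choose u hu huw using hf
  refine ⟨univ.image u, ?_, ?_, ?_⟩
  · intro i hi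
    obtain ⟨j, -, rfl⟩ := mem_image.1 hi
    exact hu j
  · refine card_image_le.trans ?_
    rw [card_univ, Fintype.card_fin]
    exact (Submodule.finrank_le _).trans finrank_quotient_augIdeal_cube_le
  · refine Eq.trans ?_ hspan
    rw [coe_image, coe_univ, Set.image_univ, ← Set.range_comp]
    exact congrArg (fun f => Submodule.span (ZMod p) (Set.range f)) (funext huw)

theorem one_sub_sum_smul_single_mem {ι : Type*} [Fact p.Prime] (g : ι → Fin 3 → ZMod p)
    {R : Finset ι} {α : ι → ZMod p} (h1 : ∑ i ∈ R, α i = 1) (h0 : ∑ i ∈ R, α i • g i = 0) :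
    1 - ∑ i ∈ R, α i • single (g i) 1 ∈ augIdeal p ^ 2 := by
  let φ : (Fin 3 → ZMod p) →+
      AddMonoidAlgebra (ZMod p) (Fin 3 → ZMod p) ⧸ augIdeal p ^ 2 :=
    AddMonoidHom.mk' (fun x => Ideal.Quotient.mk _ (1 - single x 1)) fun x y => by
      rw [← map_add, Ideal.Quotient.eq]
      have h := Ideal.mul_mem_mul (single_sub_one_mem x) (single_sub_one_mem y)
      rw [← pow_two] at h
      convert neg_mem h using 1
      rw [← mul_one (1 : ZMod p), ← single_mul_single, mul_one]
      ring
  rw [← Ideal.Quotient.eq_zero_iff_mem]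
  have h := congrArg (φ.toZModLinearMap p) h0
  simp only [map_sum, map_smul, map_zero] at h
  rw [← h]
  have h2 : (1 : AddMonoidAlgebra (ZMod p) (Fin 3 → ZMod p)) - ∑ i ∈ R, α i • single (g i) 1 =
      ∑ i ∈ R, α i • (1 - single (g i) 1) := by
    simp only [smul_sub, sum_sub_distrib, ← sum_smul, h1, one_smul]
  rw [h2, map_sum]
  rfl

theorem exists_mem_span_one_sub_mem [Fact p.Prime] (hodd : Odd p) (g : ι → Fin 3 → ZMod p)
    {R : Finset ι} (h : 4 * p - 2 ≤ R.card)
    (hne : ∀ B ⊆ R, ∑ i ∈ B, g i = 0 → B.card ≠ p) :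
    ∃ c ∈ Submodule.span (ZMod p) ((fun i => single (g i) (1 : ZMod p)) '' (R : Set ι)),
      1 - c ∈ augIdeal p ^ 2 := by
  by_cases hmem : ((1 : ZMod p), (0 : Fin 3 → ZMod p)) ∈
      Submodule.span (ZMod p) ((fun i => ((1 : ZMod p), g i)) '' (R : Set ι))
  · rw [Submodule.mem_span_image_finset_iff_exists_fun] at hmem
    obtain ⟨α, hα⟩ := hmem
    simp only [Prod.smul_mk, smul_eq_mul, mul_one, Prod.ext_iff, Prod.fst_sum, Prod.snd_sum] at hα
    exact ⟨∑ i : R, α i • single (g i) 1, Submodule.sum_mem _ fun i _ =>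
      Submodule.smul_mem _ _ (Submodule.subset_span ⟨i, i.2, rfl⟩),
      one_sub_sum_smul_single_mem (R := univ) (fun i : R => g i) hα.1 hα.2⟩
  · exfalso
    obtain ⟨f, hf, hker⟩ := Submodule.exists_le_ker_of_notMem hmem
    obtain ⟨B, hB, h0, hc⟩ := exists_zero_sum_card_eq_prime hodd g h fun B hB h0 => by
      have hz (i) (hi : i ∈ B) : f (1, g i) = 0 :=
        hker (Submodule.subset_span ⟨i, hB hi, rfl⟩)
      have hs : f (∑ i ∈ B, (1, g i)) = 0 := by rw [map_sum]; exact sum_eq_zero hz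
      have he : ∑ i ∈ B, ((1 : ZMod p), g i) = (B.card : ZMod p) • (1, 0) := by
        simp [Prod.ext_iff, Prod.fst_sum, Prod.snd_sum, h0]
      rw [he, map_smul, smul_eq_mul] at hs
      exact (ZMod.natCast_eq_zero_iff _ _).1 ((mul_eq_zero.1 hs).resolve_right hf)
    exact hne B hB h0 hc

/-- `HasBlocks g E n R` says that `R` contains `n` disjoint blocks, each carrying a linear
combination of the group elements `g i` congruent to `1 - E` modulo the cube of the augmentation
ideal. -/
def HasBlocks (g : ι → Fin 3 → ZMod p) (E : AddMonoidAlgebra (ZMod p) (Fin 3 → ZMod p)) :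
    ℕ → Finset ι → Prop
  | 0, _ => True
  | n + 1, R => ∃ B ⊆ R,
      (∃ c ∈ Submodule.span (ZMod p) ((fun i => single (g i) (1 : ZMod p)) '' (B : Set ι)),
        1 - c - E ∈ augIdeal p ^ 3) ∧ HasBlocks g E n (R \ B)

theorem exists_hasBlocks [Fact p.Prime] (hodd : Odd p) (g : ι → Fin 3 → ZMod p) (n : ℕ)
    {R : Finset ι} (h : 10 * n + (4 * p - 2) ≤ R.card)
    (hne : ∀ B ⊆ R, ∑ i ∈ B, g i = 0 → B.card ≠ p) :
    ∃ E ∈ augIdeal p ^ 2, HasBlocks g E (n + 1) R := by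
  induction n generalizing R with
  | zero =>
    obtain ⟨c, hc, hE⟩ := exists_mem_span_one_sub_mem hodd g (by omega) hne
    exact ⟨1 - c, hE, R, le_rfl, ⟨c, hc, by simp⟩, trivial⟩
  | succ n ih =>
    obtain ⟨B, hB, hcard, hspan⟩ := exists_subset_card_le_ten_span_eq
      (fun i => Ideal.Quotient.mk (augIdeal p ^ 3) (single (g i) 1)) R
    obtain ⟨E, hE, hblocks⟩ := ih (R := R \ B)
      (by rw [card_sdiff_of_subset hB]; omega) fun C hC => hne C (hC.trans sdiff_subset)
    refine ⟨E, hE, B, hB, ?_, hblocks⟩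
    obtain ⟨C, hC, ⟨c, hc, hcE⟩, -⟩ := hblocks
    have hmap (X : Finset ι) : Submodule.span (ZMod p)
        ((fun i => Ideal.Quotient.mk (augIdeal p ^ 3) (single (g i) 1)) '' (X : Set ι)) =
        (Submodule.span (ZMod p) ((fun i => single (g i) (1 : ZMod p)) '' (X : Set ι))).map
          (Ideal.Quotient.mkₐ (ZMod p) (augIdeal p ^ 3)).toLinearMap := by
      rw [Submodule.map_span, Set.image_image]
      rfl
    rw [hmap, hmap] at hspan
    have hcR : c ∈ Submodule.span (ZMod p)
        ((fun i => single (g i) (1 : ZMod p)) '' (R : Set ι)) :=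
      Submodule.span_mono (Set.image_mono (hC.trans sdiff_subset)) hc
    obtain ⟨b, hb, hbc⟩ := hspan.ge (Submodule.mem_map_of_mem hcR)
    refine ⟨b, hb, ?_⟩
    have hbc' : b - c ∈ augIdeal p ^ 3 := Ideal.Quotient.eq.1 hbc
    convert sub_mem hcE hbc' using 1
    ring

theorem HasBlocks.exists_product [Fact p.Prime] {g : ι → Fin 3 → ZMod p}
    {E : AddMonoidAlgebra (ZMod p) (Fin 3 → ZMod p)} (hE : E ∈ augIdeal p ^ 2) {n : ℕ}
    {R : Finset ι} (h : HasBlocks g E n R) :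
    ∃ P, P - E ^ n ∈ augIdeal p ^ (2 * n + 1) ∧ P - 1 ∈ Submodule.span (ZMod p)
      ((fun B => single (∑ i ∈ B, g i) (1 : ZMod p)) ''
        {B : Finset ι | B ⊆ R ∧ B.Nonempty ∧ B.card ≤ n}) := by
  induction n generalizing R with
  | zero => exact ⟨1, by simp, by simp⟩
  | succ n ih =>
    obtain ⟨B, hB, ⟨c, hc, hcE⟩, hrest⟩ := h
    obtain ⟨P, hPE, hP1⟩ := ih hrest
    refine ⟨P * (1 - c), ?_, ?_⟩
    · have hP : P ∈ augIdeal p ^ (2 * n) := by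
        have h1 := Ideal.pow_le_pow_right (Nat.le_succ (2 * n)) hPE
        have h2 := Ideal.pow_mem_pow hE n
        rw [← pow_mul] at h2
        simpa using add_mem h1 h2
      have h1 := Ideal.mul_mem_mul hPE hE
      have h2 := Ideal.mul_mem_mul hP hcE
      rw [← pow_add] at h1 h2
      convert add_mem h1 h2 using 1 <;> ring
    · rw [show P * (1 - c) - 1 = (P - 1) - (P - 1) * c - c by ring]
      refine sub_mem (sub_mem ?_ ?_) ?_
      · refine Submodule.span_mono (Set.image_mono ?_) hP1
        exact fun C hC => ⟨hC.1.trans sdiff_subset, hC.2.1, hC.2.2.trans n.le_succ⟩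
      · have h1 := Submodule.mul_mem_mul hP1 hc
        rw [Submodule.span_mul_span] at h1
        refine Submodule.span_mono ?_ h1
        rintro _ ⟨_, ⟨C, hC, rfl⟩, _, ⟨i, hi, rfl⟩, rfl⟩
        have hiC : i ∉ C := fun h => (mem_sdiff.1 (hC.1 h)).2 hi
        refine ⟨insert i C, ⟨insert_subset (hB hi) (hC.1.trans sdiff_subset),
          insert_nonempty _ _, ?_⟩, ?_⟩
        · rw [card_insert_of_notMem hiC]
          exact Nat.succ_le_succ hC.2.2
        · simp [sum_insert hiC, single_mul_single, add_comm]
      · refine Submodule.span_mono ?_ hc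
        rintro _ ⟨i, hi, rfl⟩
        exact ⟨{i}, ⟨singleton_subset_iff.2 (hB hi), singleton_nonempty i, by simp⟩, by simp⟩

theorem exists_zero_sum_card_le_of_large [Fact p.Prime] {q : ℕ} (hq : p = 2 * q + 1)
    (g : ι → Fin 3 → ZMod p) {s : Finset ι} (h : 38 * q ≤ s.card + 8) :
    ∃ B ⊆ s, B.Nonempty ∧ ∑ i ∈ B, g i = 0 ∧ B.card ≤ 3 * q := by
  have hp := (Fact.out : p.Prime).two_le
  by_contra! hcon
  have hne (B) (hB : B ⊆ s) (h0 : ∑ i ∈ B, g i = 0) : B.card ≠ p := fun hc => by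
    have := hcon B hB (card_pos.1 (by omega)) h0
    omega
  obtain ⟨E, hE, hblocks⟩ := exists_hasBlocks ⟨q, hq⟩ g (3 * q - 1) (R := s) (by omega) hne
  rw [Nat.sub_add_cancel (by omega)] at hblocks
  obtain ⟨P, hPE, hP1⟩ := hblocks.exists_product hE
  have hE0 : E ^ (3 * q) = 0 := pow_eq_zero_of_le (by omega)
    (pow_prime_eq_zero_of_mem_augIdeal (Ideal.pow_le_self two_ne_zero hE))
  rw [hE0, sub_zero, show 2 * (3 * q) + 1 = 3 * p - 2 by omega, augIdeal_pow_eq_bot,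
    Ideal.mem_bot] at hPE
  rw [hPE, zero_sub] at hP1
  have hcoeff {x} (hx : x ∈ Submodule.span (ZMod p)
      ((fun B => single (∑ i ∈ B, g i) (1 : ZMod p)) ''
        {B : Finset ι | B ⊆ s ∧ B.Nonempty ∧ B.card ≤ 3 * q})) : x.coeff 0 = 0 := by
    induction hx using Submodule.span_induction with
    | mem x hx =>
      obtain ⟨B, hB, rfl⟩ := hx
      have h0 : ∑ i ∈ B, g i ≠ 0 := fun h0 =>
        absurd (hcon B hB.1 hB.2.1 h0) (not_lt.2 hB.2.2)
      simp [h0]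
    | zero => simp
    | add x y _ _ hx hy => simp [hx, hy]
    | smul a x _ hx => simp [hx]
  have := hcoeff hP1
  simp [one_def] at this

theorem hasDisjointZeroSums_of_card_ge_max [Fact p.Prime] {q : ℕ} (hq : p = 2 * q + 1)
    (g : ι → Fin 3 → ZMod p) {k : ℕ} (hk : 0 < k) {s : Finset ι}
    (h : 3 * q * k + 2 * p + 5 ≤ s.card) : HasDisjointZeroSums g k s := by
  induction k, hk using Nat.le_induction generalizing s with
  | base => exact hasDisjointZeroSums_of_card_ge hq g one_pos (by omega)
  | succ k hk ih =>
    by_cases hsmall : k + 1 ≤ q + 7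
    · exact hasDisjointZeroSums_of_card_ge hq g k.succ_pos (by nlinarith)
    · obtain ⟨B, hB, hne, h0, hc⟩ := exists_zero_sum_card_le_of_large hq g (s := s) (by
        have h1 : 3 * q * (q + 8) ≤ 3 * q * (k + 1) := Nat.mul_le_mul_left _ (by omega)
        have h2 : 10 * q ≤ 3 * (q * q) + 15 := by
          rcases Nat.lt_or_ge q 4 with hq4 | hq4
          · interval_cases q <;> norm_num
          · nlinarith
        nlinarith)
      refine ⟨B, hB, hne, h0, ih ?_⟩
      rw [card_sdiff_of_subset hB]
      rw [mul_add] at h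
      omega

end Blocks

theorem HasDisjointZeroSums.exists_multiset {G ι : Type*} [AddCommGroup G] [DecidableEq ι]
    {g : ι → G} {k : ℕ} {s : Finset ι} (h : HasDisjointZeroSums g k s) :
    ∃ L : Multiset (Multiset G), L.card = k ∧ L.sum ≤ s.val.map g ∧
      ∀ T ∈ L, T ≠ 0 ∧ T.sum = 0 := by
  induction k generalizing s with
  | zero => exact ⟨0, by simp⟩
  | succ k ih =>
    obtain ⟨B, hB, hne, h0, hrest⟩ := h
    obtain ⟨L, hcard, hle, hL⟩ := ih hrest
    refine ⟨B.val.map g ::ₘ L, by simp [hcard], ?_, ?_⟩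
    · rw [Multiset.sum_cons]
      refine (add_le_add_right hle _).trans ?_
      rw [← Multiset.map_add, sdiff_val, add_tsub_cancel_of_le (val_le_iff.2 hB)]
    · intro T hT
      rcases Multiset.mem_cons.1 hT with rfl | hT
      · exact ⟨by simpa using hne.ne_empty, h0⟩
      · exact hL T hT

theorem Dk_zmod_p_pow_three_le (p k : ℕ) (hp : p.Prime) (hodd : Odd p) (hk : 0 < k) :
    disjointZeroSumConstant k (Fin 3 → ZMod p) ≤
      max (5 * p - 2) (3 * (p - 1) / 2 * k + 2 * p + 5) := by
  have : Fact p.Prime := ⟨hp⟩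
  obtain ⟨q, hq⟩ := hodd
  refine Nat.sInf_le fun S hS => ?_
  induction S using Quotient.inductionOn with
  | _ l =>
    have hl : (univ.val.map l.get : Multiset (Fin 3 → ZMod p)) = ⟦l⟧ := by
      simp [Fin.univ_val_map]
    rw [← hl]
    refine (hasDisjointZeroSums_of_card_ge_max hq l.get hk ?_).exists_multiset
    rw [card_univ, Fintype.card_fin]
    have h3 : 3 * (p - 1) / 2 = 3 * q := by omega
    rw [h3] at hS
    exact (le_max_right _ _).trans hS.ge
end

section
/- Let A be a sequence of 15 elements of (ℤ/7ℤ)^2 containing no nonempty zero-sum subsequence of length at most 7. Then there exists a cyclic subgroup of (ℤ/7ℤ)^2 containing at least 3 elements of A (counted with multiplicity). -/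
/-! ### Bit-encoded subset sums

A natural number `S` encodes a set of pairs (length bound, group element): relative to `x`, `y` in a
group of exponent 7, a set bit `n` stands for the bound `n / 49` and the element
`(n / 7) • x + n • y`. -/

namespace BitSums

/-- The bits `n < 343` with `7 ∣ n`. -/
def firstColumn : ℕ := (2 ^ 343 - 1) / (2 ^ 7 - 1)

/-- The bits `n < 343` with `n % 49 < 7`. -/
def firstRow : ℕ := (2 ^ 343 - 1) / (2 ^ 49 - 1) * (2 ^ 7 - 1)

/-- Translate the encoded elements by `x`. -/
def shiftX (S : ℕ) : ℕ := S <<< 7 ||| (S >>> 42 &&& firstRow)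

/-- Translate the encoded elements by `y`. -/
def shiftY (S : ℕ) : ℕ := (S &&& 63 * firstColumn) <<< 1 ||| (S >>> 6 &&& firstColumn)

/-- Translate the encoded elements by `i • x + j • y`. -/
def shift (i j S : ℕ) : ℕ := shiftX^[i] (shiftY^[j] S)

/-- Extend the encoded subset sums by the new summand `i • x + j • y`. -/
def extend (i j S : ℕ) : ℕ := S ||| shift i j S <<< 49

/-- The subset sums of the empty sequence: zero, for each length bound up to 6. -/
def emptySums : ℕ := (2 ^ 343 - 1) / (2 ^ 49 - 1)

/-- Adding the summand `i • x + j • y` creates a zero-sum subsequence of length at most 7. -/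
def blocked (i j S : ℕ) : Bool := (shift i j S).testBit 294

/-- Search for a sequence without short zero-sum subsequences which extends the one encoded by `S`
by two elements on each of the lines through `x + c • y` for `c` in the list, where a single line
may get only one element if `slack` is set. The result is `true` if no such extension exists. -/
def refute : List ℕ → Bool → ℕ → Bool
  | [], _, _ => false
  | c :: cs, slack, S => [1, 2, 3, 4, 5, 6].all fun a =>
      blocked a (a * c % 7) S ||
        ((!slack || refute cs false (extend a (a * c % 7) S)) &&
          [1, 2, 3, 4, 5, 6].all fun b =>
            blocked b (b * c % 7) (extend a (a * c % 7) S) ||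
              refute cs slack (extend b (b * c % 7) (extend a (a * c % 7) S)))

theorem refute_lines :
    refute [1, 2, 3, 4, 5, 6] true (extend 1 0 (extend 0 1 emptySums)) = true := by
  decide +kernel

variable {V : Type*} [AddCommGroup V] {x y v : V} {s : Multiset V} {S : ℕ}

/-- Every set bit `n` of `S` encodes, translated by `v`, the sum of a subsequence of `s` of length
at most `n / 49`. -/
def Sums (x y v : V) (s : Multiset V) (S : ℕ) : Prop :=
  ∀ n, S.testBit n → ∃ T ≤ s, T.card ≤ n / 49 ∧ T.sum + v = (n / 7) • x + n • y

theorem of_testBit {M k n : ℕ} {p : ℕ → Prop} (hM : M < 2 ^ k)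
    (hp : ∀ n < k, M.testBit n → p n) (h : M.testBit n) : p n := by
  refine hp n ?_ h
  by_contra hn
  rw [Nat.testBit_lt_two_pow (hM.trans_le (Nat.pow_le_pow_right two_pos (not_lt.1 hn)))] at h
  exact Bool.false_ne_true h

set_option exponentiation.threshold 343

theorem mod_lt_of_testBit_columns {n : ℕ} (h : (63 * firstColumn).testBit n) : n % 7 < 6 :=
  of_testBit (k := 343) (p := fun n => n % 7 < 6) (by decide +kernel) (by decide +kernel) h

theorem mod_eq_of_testBit_firstColumn {n : ℕ} (h : firstColumn.testBit n) : n % 7 = 0 :=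
  of_testBit (k := 343) (p := fun n => n % 7 = 0) (by decide +kernel) (by decide +kernel) h

theorem mod_lt_of_testBit_firstRow {n : ℕ} (h : firstRow.testBit n) : n % 49 < 7 :=
  of_testBit (k := 343) (p := fun n => n % 49 < 7) (by decide +kernel) (by decide +kernel) h

theorem mod_eq_of_testBit_emptySums {n : ℕ} (h : emptySums.testBit n) : n % 49 = 0 :=
  of_testBit (k := 343) (p := fun n => n % 49 = 0) (by decide +kernel) (by decide +kernel) h

theorem add_mul_seven_nsmul (h7 : ∀ v : V, 7 • v = 0) (m k : ℕ) (v : V) :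
    (m + 7 * k) • v = m • v := by
  rw [add_nsmul, mul_comm, mul_nsmul', h7, smul_zero, add_zero]

theorem sums_emptySums (h7 : ∀ v : V, 7 • v = 0) : Sums x y 0 0 emptySums := by
  intro n hn
  obtain ⟨k, rfl⟩ := Nat.dvd_of_mod_eq_zero (mod_eq_of_testBit_emptySums hn)
  refine ⟨0, le_rfl, by simp, ?_⟩
  rw [show 49 * k / 7 = 0 + 7 * k by omega, show 49 * k = 0 + 7 * (7 * k) by omega,
    add_mul_seven_nsmul h7, add_mul_seven_nsmul h7]
  simp

theorem sums_shiftX (h7 : ∀ v : V, 7 • v = 0) (h : Sums x y v s S) :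
    Sums x y (v + x) s (shiftX S) := by
  intro n hn
  simp only [shiftX, Nat.testBit_or, Nat.testBit_and, Nat.testBit_shiftLeft,
    Nat.testBit_shiftRight, Bool.or_eq_true, Bool.and_eq_true, decide_eq_true_eq] at hn
  rcases hn with ⟨h1, h2⟩ | ⟨h1, h2⟩
  · obtain ⟨m, rfl⟩ := Nat.exists_eq_add_of_le' h1
    obtain ⟨T, hT, hc, hs⟩ := h _ h2
    rw [Nat.add_sub_cancel] at hc hs
    refine ⟨T, hT, by omega, ?_⟩
    rw [← add_assoc, hs, show (m + 7) / 7 = m / 7 + 1 by omega, add_nsmul, add_nsmul y m, h7]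
    abel
  · obtain ⟨T, hT, hc, hs⟩ := h _ h1
    have := mod_lt_of_testBit_firstRow h2
    refine ⟨T, hT, by omega, ?_⟩
    rw [← add_assoc, hs, ← add_mul_seven_nsmul h7 (n / 7) 1, ← add_mul_seven_nsmul h7 n 6,
      show n / 7 + 7 * 1 = (42 + n) / 7 + 1 by omega, show n + 7 * 6 = 42 + n by omega,
      succ_nsmul]
    abel

theorem sums_shiftY (h7 : ∀ v : V, 7 • v = 0) (h : Sums x y v s S) :
    Sums x y (v + y) s (shiftY S) := by
  intro n hn
  simp only [shiftY, Nat.testBit_or, Nat.testBit_and, Nat.testBit_shiftLeft,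
    Nat.testBit_shiftRight, Bool.or_eq_true, Bool.and_eq_true, decide_eq_true_eq] at hn
  rcases hn with ⟨h1, h2, h3⟩ | ⟨h1, h2⟩
  · obtain ⟨m, rfl⟩ := Nat.exists_eq_add_of_le' h1
    obtain ⟨T, hT, hc, hs⟩ := h _ h2
    have := mod_lt_of_testBit_columns h3
    rw [Nat.add_sub_cancel] at hc hs this
    refine ⟨T, hT, by omega, ?_⟩
    rw [← add_assoc, hs, show (m + 1) / 7 = m / 7 by omega, add_nsmul, one_nsmul, add_assoc]
  · obtain ⟨T, hT, hc, hs⟩ := h _ h1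
    have := mod_eq_of_testBit_firstColumn h2
    refine ⟨T, hT, by omega, ?_⟩
    rw [← add_assoc, hs, ← add_mul_seven_nsmul h7 n 1, show (6 + n) / 7 = n / 7 by omega,
      show n + 7 * 1 = 6 + n + 1 by omega, succ_nsmul, add_assoc]

theorem sums_shift (h7 : ∀ v : V, 7 • v = 0) (i j : ℕ) (h : Sums x y 0 s S) :
    Sums x y (i • x + j • y) s (shift i j S) := by
  induction i with
  | zero =>
    induction j with
    | zero => simpa [shift] using h
    | succ j ih =>
      have := sums_shiftY h7 ih
      rwa [add_assoc, ← succ_nsmul, shift, Function.iterate_zero_apply,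
        ← Function.iterate_succ_apply' shiftY] at this
  | succ i ih =>
    have := sums_shiftX h7 ih
    rwa [add_right_comm, ← succ_nsmul, shift, ← Function.iterate_succ_apply' shiftX] at this

theorem sums_extend (h7 : ∀ v : V, 7 • v = 0) (i j : ℕ) (h : Sums x y 0 s S) :
    Sums x y 0 ((i • x + j • y) ::ₘ s) (extend i j S) := by
  intro n hn
  simp only [extend, Nat.testBit_or, Nat.testBit_shiftLeft, Bool.or_eq_true, Bool.and_eq_true,
    decide_eq_true_eq] at hn
  rcases hn with h1 | ⟨h1, h2⟩
  · obtain ⟨T, hT, hc, hs⟩ := h _ h1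
    exact ⟨T, hT.trans (Multiset.le_cons_self _ _), hc, hs⟩
  · obtain ⟨m, rfl⟩ := Nat.exists_eq_add_of_le' h1
    obtain ⟨T, hT, hc, hs⟩ := sums_shift h7 i j h _ h2
    rw [Nat.add_sub_cancel] at hc hs
    refine ⟨(i • x + j • y) ::ₘ T, Multiset.cons_le_cons _ hT, ?_, ?_⟩
    · rw [Multiset.card_cons]
      omega
    · rw [Multiset.sum_cons, add_zero, add_comm, hs, show (m + 49) / 7 = m / 7 + 7 * 1 by omega,
        show m + 49 = m + 7 * 7 by omega, add_mul_seven_nsmul h7, add_mul_seven_nsmul h7]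

/-- `A` has no nonempty zero-sum subsequence of length at most 7. -/
def ShortZeroSumFree (A : Multiset V) : Prop :=
  ∀ T ≤ A, T ≠ 0 → T.card ≤ 7 → T.sum ≠ 0

theorem ShortZeroSumFree.blocked_eq_false {A : Multiset V} (hA : ShortZeroSumFree A)
    (h7 : ∀ v : V, 7 • v = 0) {i j : ℕ} (h : Sums x y 0 s S)
    (hs : (i • x + j • y) ::ₘ s ≤ A) : blocked i j S = false := by
  by_contra hb
  obtain ⟨T, hT, hc, hsum⟩ := sums_shift h7 i j h 294 (by simpa [blocked] using hb)
  refine hA ((i • x + j • y) ::ₘ T) ((Multiset.cons_le_cons _ hT).trans hs)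
    (Multiset.cons_ne_zero) (by rw [Multiset.card_cons]; omega) ?_
  have e1 := add_mul_seven_nsmul h7 0 6 x
  have e2 := add_mul_seven_nsmul h7 0 42 y
  norm_num at e1 e2 hsum
  rw [Multiset.sum_cons, add_comm, hsum, e1, e2, add_zero]

theorem exists_nsmul_of_mem_zmultiples (h7 : ∀ v : V, 7 • v = 0) {c : ℕ}
    (hv : v ∈ AddSubgroup.zmultiples (x + c • y)) (hv0 : v ≠ 0) :
    ∃ a ∈ [1, 2, 3, 4, 5, 6], v = a • x + (a * c % 7) • y := by
  obtain ⟨k, rfl⟩ := AddSubgroup.mem_zmultiples_iff.1 hv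
  obtain ⟨a, ha⟩ := Int.eq_ofNat_of_zero_le (Int.emod_nonneg k (by norm_num : (7 : ℤ) ≠ 0))
  have hk : k • (x + c • y) = a • (x + c • y) := by
    rw [← natCast_zsmul _ a, ← ha]
    conv_lhs => rw [← Int.emod_add_mul_ediv k 7, add_zsmul, mul_comm, mul_zsmul]
    rw [show (7 : ℤ) • (x + c • y) = 0 from mod_cast h7 (x + c • y), smul_zero, add_zero]
  have ha0 : a ≠ 0 := by
    rintro rfl
    exact hv0 (by rw [hk, zero_nsmul])
  refine ⟨a, ?_, ?_⟩
  · have : a < 7 := by omega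
    interval_cases a <;> simp_all
  · rw [hk, nsmul_add, ← mul_nsmul', ← add_mul_seven_nsmul h7 (a * c % 7) (a * c / 7),
      Nat.mod_add_div]

open Classical in
theorem card_le_of_forall_mem_lines {A : Multiset V}
    (h2 : ∀ g, (A.filter (· ∈ AddSubgroup.zmultiples g)).card ≤ 2) (L : List V) :
    ∀ R ≤ A, (∀ v ∈ R, ∃ g ∈ L, v ∈ AddSubgroup.zmultiples g) → R.card ≤ 2 * L.length := by
  induction L with
  | nil =>
    intro R _ h
    simp [Multiset.eq_zero_of_forall_notMem fun v hv => by simpa using h v hv]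
  | cons g L ih =>
    intro R hR h
    have h1 := (Multiset.card_le_card (Multiset.filter_le_filter _ hR)).trans (h2 g)
    have h3 := ih (R.filter (· ∉ AddSubgroup.zmultiples g)) ((Multiset.filter_le _ _).trans hR) (by
      intro v hv
      rw [Multiset.mem_filter] at hv
      simpa [hv.2] using h v hv.1)
    rw [← Multiset.filter_add_not (· ∈ AddSubgroup.zmultiples g) R, Multiset.card_add,
      List.length_cons]
    omega

open Classical in
theorem refute_eq_false (h7 : ∀ v : V, 7 • v = 0) {A : Multiset V} (hA : ShortZeroSumFree A)
    (h2 : ∀ g, (A.filter (· ∈ AddSubgroup.zmultiples g)).card ≤ 2) (L : List ℕ) :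
    ∀ (slack : Bool) (S : ℕ) (s R : Multiset V), Sums x y 0 s S → s + R ≤ A →
      (∀ v ∈ R, ∃ c ∈ L, v ∈ AddSubgroup.zmultiples (x + c • y)) →
      2 * L.length ≤ R.card + slack.toNat → refute L slack S = false := by
  induction L with
  | nil => intros; rfl
  | cons c L ih =>
    intro slack S s R hS hle hR hcard
    set P := R.filter (· ∈ AddSubgroup.zmultiples (x + c • y)) with hP
    set Q := R.filter (· ∉ AddSubgroup.zmultiples (x + c • y)) with hQ
    have hPQ : P + Q = R := Multiset.filter_add_not _ R
    have hRA : R ≤ A := (Multiset.le_add_left _ _).trans hle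
    have hP2 : P.card ≤ 2 := (Multiset.card_le_card (Multiset.filter_le_filter _ hRA)).trans (h2 _)
    have hQL : ∀ v ∈ Q, ∃ c ∈ L, v ∈ AddSubgroup.zmultiples (x + c • y) := by
      intro v hv
      rw [hQ, Multiset.mem_filter] at hv
      simpa [hv.2] using hR v hv.1
    have hQ2 : Q.card ≤ 2 * L.length := by
      simpa using card_le_of_forall_mem_lines h2 (L.map fun c => x + c • y) Q
        ((Multiset.filter_le _ _).trans hRA) (by simpa using hQL)
    have hform : ∀ v ∈ P, ∃ a ∈ [1, 2, 3, 4, 5, 6], v = a • x + (a * c % 7) • y := by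
      intro v hv
      rw [hP, Multiset.mem_filter] at hv
      refine exists_nsmul_of_mem_zmultiples h7 hv.2 ?_
      rintro rfl
      exact hA {0} (by simpa using Multiset.mem_of_le hRA hv.1) (by simp) (by simp) (by simp)
    have hsum : P.card + Q.card = R.card := by rw [← hPQ, Multiset.card_add]
    have hslack := Bool.toNat_le slack
    rw [List.length_cons] at hcard
    rw [← hPQ] at hle
    by_contra hr
    rw [Bool.not_eq_false, refute, List.all_eq_true] at hr
    obtain hP1 | hP1 : P.card = 1 ∨ P.card = 2 := by omega
    · obtain ⟨v, hv⟩ := Multiset.card_eq_one.1 hP1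
      obtain ⟨a, ha, rfl⟩ := hform v (by simp [hv])
      have hle' : (a • x + (a * c % 7) • y) ::ₘ s + Q ≤ A := by
        rwa [hv, add_left_comm, Multiset.singleton_add, ← Multiset.cons_add] at hle
      have h1 := hr a ha
      obtain rfl : slack = true := by
        cases slack
        · simp at hcard; omega
        · rfl
      rw [hA.blocked_eq_false h7 hS ((Multiset.le_add_right _ _).trans hle'),
        ih false _ _ Q (sums_extend h7 _ _ hS) hle' hQL (by simp at hcard ⊢; omega)] at h1
      simp at h1
    · obtain ⟨v, w, hvw⟩ := Multiset.card_eq_two.1 hP1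
      obtain ⟨a, ha, rfl⟩ := hform v (by simp [hvw])
      obtain ⟨b, hb, rfl⟩ := hform w (by simp [hvw])
      have hle' : (b • x + (b * c % 7) • y) ::ₘ (a • x + (a * c % 7) • y) ::ₘ s + Q ≤ A := by
        refine le_of_eq_of_le ?_ hle
        rw [hvw, Multiset.insert_eq_cons, ← Multiset.singleton_add, ← Multiset.singleton_add,
          ← Multiset.singleton_add]
        abel
      have hs1 := (Multiset.le_add_right _ _).trans hle'
      have h1 := hr a ha
      rw [hA.blocked_eq_false h7 hS ((Multiset.le_cons_self _ _).trans hs1), Bool.false_or,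
        Bool.and_eq_true, List.all_eq_true] at h1
      have h3 := h1.2 b hb
      have hS1 := sums_extend h7 a (a * c % 7) hS
      rw [hA.blocked_eq_false h7 hS1 hs1,
        ih slack _ _ Q (sums_extend h7 _ _ hS1) hle' hQL (by omega)] at h3
      simp at h3

end BitSums

open BitSums

theorem smul_mem_zmultiples (a : ZMod 7) (g : Fin 2 → ZMod 7) :
    a • g ∈ AddSubgroup.zmultiples g := by
  refine AddSubgroup.mem_zmultiples_iff.2 ⟨a.val, ?_⟩
  rw [natCast_zsmul, ← Nat.cast_smul_eq_nsmul (ZMod 7), ZMod.natCast_zmod_val]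

theorem exists_smul_add_smul {x y : Fin 2 → ZMod 7} (hx : x ≠ 0)
    (hy : y ∉ AddSubgroup.zmultiples x) (v : Fin 2 → ZMod 7) :
    ∃ i j : ZMod 7, v = i • x + j • y := by
  have : Fact (Nat.Prime 7) := ⟨by norm_num⟩
  have hli : LinearIndependent (ZMod 7) ![x, y] := by
    rw [LinearIndependent.pair_iff' hx]
    rintro a rfl
    exact hy (smul_mem_zmultiples a x)
  have hspan := hli.span_eq_top_of_card_eq_finrank (by simp)
  have hv : v ∈ Submodule.span (ZMod 7) (Set.range ![x, y]) := by rw [hspan]; trivial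
  rw [Matrix.range_cons, Matrix.range_cons, Matrix.range_empty, Set.union_empty,
    Set.singleton_union, Submodule.mem_span_pair] at hv
  obtain ⟨i, j, h⟩ := hv
  exact ⟨i, j, h.symm⟩

theorem mem_line_of_notMem {x y : Fin 2 → ZMod 7} (hx : x ≠ 0)
    (hy : y ∉ AddSubgroup.zmultiples x) {v : Fin 2 → ZMod 7}
    (hvx : v ∉ AddSubgroup.zmultiples x) (hvy : v ∉ AddSubgroup.zmultiples y) :
    ∃ c ∈ [1, 2, 3, 4, 5, 6], v ∈ AddSubgroup.zmultiples (x + c • y) := by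
  have : Fact (Nat.Prime 7) := ⟨by norm_num⟩
  obtain ⟨i, j, rfl⟩ := exists_smul_add_smul hx hy v
  have hi : i ≠ 0 := by
    rintro rfl
    exact hvy (by simpa using smul_mem_zmultiples j y)
  have hj : j ≠ 0 := by
    rintro rfl
    exact hvx (by simpa using smul_mem_zmultiples i x)
  refine ⟨(i⁻¹ * j).val, ?_, ?_⟩
  · have h0 : (i⁻¹ * j).val ≠ 0 := by simp [ZMod.val_eq_zero, hi, hj]
    have h1 := ZMod.val_lt (i⁻¹ * j)
    generalize (i⁻¹ * j).val = c at *
    interval_cases c <;> simp_all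
  · convert smul_mem_zmultiples i (x + (i⁻¹ * j).val • y) using 1
    rw [← Nat.cast_smul_eq_nsmul (ZMod 7), ZMod.natCast_zmod_val, smul_add, smul_smul,
      mul_inv_cancel_left₀ hi]

theorem cyclic_subgroup_with_three_elements
    (A : Multiset (Fin 2 → ZMod 7)) (hA : A.card = 15)
    (hzs : ∀ T : Multiset (Fin 2 → ZMod 7), T ≤ A → T ≠ 0 → T.card ≤ 7 → T.sum ≠ 0) :
    ∃ g : Fin 2 → ZMod 7, ∃ B : Multiset (Fin 2 → ZMod 7),
      B ≤ A ∧ B.card = 3 ∧ ∀ x ∈ B, x ∈ AddSubgroup.zmultiples g := by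
  classical
  have h7 : ∀ v : Fin 2 → ZMod 7, 7 • v = 0 := fun v => by
    rw [← Nat.cast_smul_eq_nsmul (ZMod 7), ZMod.natCast_self, zero_smul]
  by_contra! hno
  have h2 : ∀ g, (A.filter (· ∈ AddSubgroup.zmultiples g)).card ≤ 2 := by
    intro g
    by_contra! h3
    obtain ⟨B, hB⟩ := Multiset.card_pos_iff_exists_mem.1
      ((Multiset.card_powersetCard 3 _).symm ▸ Nat.choose_pos (Nat.succ_le_of_lt h3))
    obtain ⟨hB, hB3⟩ := Multiset.mem_powersetCard.1 hB
    obtain ⟨v, hv, hvg⟩ := hno g B (hB.trans (Multiset.filter_le _ _)) hB3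
    exact hvg (Multiset.mem_filter.1 (Multiset.mem_of_le hB hv)).2
  obtain ⟨x, hxA⟩ := Multiset.card_pos_iff_exists_mem.1 (by omega : 0 < A.card)
  have hx0 : x ≠ 0 := by
    rintro rfl
    exact hzs {0} (by simpa using hxA) (by simp) (by simp) (by simp)
  obtain ⟨y, hyA, hy⟩ : ∃ y ∈ A, y ∉ AddSubgroup.zmultiples x := by
    by_contra! h
    have := h2 x
    rw [Multiset.filter_eq_self.2 h] at this
    omega
  set R := (A.filter (· ∉ AddSubgroup.zmultiples x)).filter (· ∉ AddSubgroup.zmultiples y) with hR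
  have hRcard : 11 ≤ R.card := by
    have e1 := congrArg Multiset.card (Multiset.filter_add_not (· ∈ AddSubgroup.zmultiples x) A)
    have e2 := congrArg Multiset.card (Multiset.filter_add_not (· ∈ AddSubgroup.zmultiples y)
      (A.filter (· ∉ AddSubgroup.zmultiples x)))
    rw [Multiset.card_add] at e1 e2
    rw [← hR] at e2
    have e3 := h2 x
    have e4 := (Multiset.card_le_card (Multiset.filter_le_filter (· ∈ AddSubgroup.zmultiples y)
      (Multiset.filter_le (· ∉ AddSubgroup.zmultiples x) A))).trans (h2 y)
    omega
  have hle : {x, y} + R ≤ A := by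
    rw [← Multiset.filter_add_not (· ∈ AddSubgroup.zmultiples x) A,
      ← Multiset.filter_add_not (· ∈ AddSubgroup.zmultiples y)
        (A.filter (· ∉ AddSubgroup.zmultiples x)), ← add_assoc]
    refine add_le_add_left (add_le_add (a := ({x} : Multiset _)) (c := {y}) ?_ ?_) _
    · simpa using hxA
    · simp [hyA, hy]
  have hS : Sums x y 0 {x, y} (extend 1 0 (extend 0 1 emptySums)) := by
    simpa using sums_extend h7 1 0 (sums_extend h7 0 1 (sums_emptySums (x := x) (y := y) h7))
  have hfalse := refute_eq_false h7 hzs h2 [1, 2, 3, 4, 5, 6] true _ _ R hS hle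
    (fun v hv => by
      simp only [hR, Multiset.mem_filter] at hv
      exact mem_line_of_notMem hx0 hy hv.1.2 hv.2) (by simp; omega)
  rw [refute_lines] at hfalse
  exact Bool.false_ne_true hfalse.symm
end
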